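/- (Ball inflation) There is an absolute constant C such that the following holds. Let p > 4, let b ≥ 1 be an integer, let ν ∈ (0,1) with 1/ν ∈ ℕ, and let I₁, I₂ ∈ P_ν([0,1]) be intervals of length ν with dist(I₁, I₂) ≥ ν. Then for every integrable g : [0,1] → ℂ and every axis-parallel square Δ' ⊂ ℝ² of side length ν^{−2b}: Avg_{Δ ∈ P_{ν^{−b}}(Δ')} Π_{i=1}^{2} (Σ_{J ∈ P_{ν^b}(I_i)} ‖E_J g‖_{L^{p/2}_#(w̃_Δ)}²)^{p/4} ≤ e^{Cp} · ν^{−1} · (b · log(1/ν))^{p/2} · Π_{i=1}^{2} (Σ_{J ∈ P_{ν^b}(I_i)} ‖E_J g‖_{L^{p/2}_#(w̃_{Δ'})}²)^{p/4}. -/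

import Mathlib

open MeasureTheory

noncomputable section

/-- The weight `w_B` attached to the axis-parallel square of center `c` and side length `R`:
`w_B(x) = (1 + |x - c|/R)^(-100)` with `|·|` the Euclidean norm on `ℝ²`. -/
def wB (c : ℝ × ℝ) (R : ℝ) (x : ℝ × ℝ) : ℝ :=
  (1 + Real.sqrt ((x.1 - c.1) ^ 2 + (x.2 - c.2) ^ 2) / R) ^ (-100 : ℤ)

/-- The product weight `w̃_B(x) = (1 + |x₁ - c₁|/R)^(-100) * (1 + |x₂ - c₂|/R)^(-100)`. -/
def wtB (c : ℝ × ℝ) (R : ℝ) (x : ℝ × ℝ) : ℝ :=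
  (1 + |x.1 - c.1| / R) ^ (-100 : ℤ) * (1 + |x.2 - c.2| / R) ^ (-100 : ℤ)

/-- The axis-parallel square `B(c, R)` with center `c` and side length `R`, as a subset of `ℝ²`. -/
def sqr (c : ℝ × ℝ) (R : ℝ) : Set (ℝ × ℝ) :=
  Set.Icc (c.1 - R / 2) (c.1 + R / 2) ×ˢ Set.Icc (c.2 - R / 2) (c.2 + R / 2)

/-- The extension operator associated to the parabola, over the interval `[a, b]`:
`(E_{[a,b]} g)(x) = ∫_{[a,b]} g(ξ) e(ξ x₁ + ξ² x₂) dξ`. -/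
def extOp (a b : ℝ) (g : ℝ → ℂ) (x : ℝ × ℝ) : ℂ :=
  ∫ ξ in Set.Icc a b,
    g ξ * Complex.exp (2 * Real.pi * Complex.I * ((ξ * x.1 + ξ ^ 2 * x.2 : ℝ) : ℂ))

/-- Weighted `L^p` norm `‖f‖_{L^p(w)} = (∫_{ℝ²} |f|^p w)^{1/p}`. -/
def wLp (p : ℝ) (w : ℝ × ℝ → ℝ) (f : ℝ × ℝ → ℂ) : ℝ :=
  (∫ x : ℝ × ℝ, ‖f x‖ ^ p * w x) ^ (1 / p)

/-- `L^p` norm over the square of center `c` and side `R`. -/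
def sqLp (p : ℝ) (c : ℝ × ℝ) (R : ℝ) (f : ℝ × ℝ → ℂ) : ℝ :=
  (∫ x in sqr c R, ‖f x‖ ^ p) ^ (1 / p)

/-- Normalized weighted `L^p` norm `‖f‖_{L^p_#(w)} = (|B|⁻¹ ∫_{ℝ²} |f|^p w)^{1/p}` where the
normalizing square has side length `R` (so `|B| = R²`). -/
def shLp (p R : ℝ) (w : ℝ × ℝ → ℝ) (f : ℝ × ℝ → ℂ) : ℝ :=
  ((R ^ 2)⁻¹ * ∫ x : ℝ × ℝ, ‖f x‖ ^ p * w x) ^ (1 / p)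

/-- Normalized `L^p` norm over the square of center `c` and side `R`:
`‖f‖_{L^p_#(B)} = (|B|⁻¹ ∫_B |f|^p)^{1/p}`. -/
def shLpSq (p : ℝ) (c : ℝ × ℝ) (R : ℝ) (f : ℝ × ℝ → ℂ) : ℝ :=
  ((R ^ 2)⁻¹ * ∫ x in sqr c R, ‖f x‖ ^ p) ^ (1 / p)

/-- `DecIneq p n D` says that the constant `D` is admissible in the `l²L^p` decoupling
inequality for the parabola at scale `δ = 1/n`: for every integrable `g : [0,1] → ℂ` and every
axis-parallel square `B` of side length `δ⁻² = n²`,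
`‖E_{[0,1]} g‖_{L^p(B)} ≤ D (Σ_{J ∈ P_δ([0,1])} ‖E_J g‖_{L^p(w_B)}²)^{1/2}`. -/
def DecIneq (p : ℝ) (n : ℕ) (D : ℝ) : Prop :=
  ∀ g : ℝ → ℂ, IntegrableOn g (Set.Icc 0 1) → ∀ c : ℝ × ℝ,
    sqLp p c ((n : ℝ) ^ 2) (extOp 0 1 g) ≤
      D * (∑ k ∈ Finset.range n,
        wLp p (wB c ((n : ℝ) ^ 2)) (extOp ((k : ℝ) / (n : ℝ)) (((k : ℝ) + 1) / (n : ℝ)) g) ^ 2)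
        ^ (1 / 2 : ℝ)

/-- The decoupling constant `D_p(δ)` for the parabola at scale `δ = 1/n`, i.e. the smallest
admissible constant in the decoupling inequality. -/
def Dconst (p : ℝ) (n : ℕ) : ℝ := sInf {D : ℝ | 0 ≤ D ∧ DecIneq p n D}

/-- Center of the `(i,j)` square in the partition of the axis-parallel square of center `c` and
side length `Rb` into axis-parallel squares of side length `r`. -/
def subCtr (c : ℝ × ℝ) (Rb r : ℝ) (i j : ℕ) : ℝ × ℝ :=
  (c.1 - Rb / 2 + ((i : ℝ) + 1 / 2) * r, c.2 - Rb / 2 + ((j : ℝ) + 1 / 2) * r)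

/-- `BilIneq p n k b M` says `M` is admissible in the bilinear decoupling inequality with
`δ = 1/n`, `ν = 1/k`: for every square `B` of side `δ⁻² = n²`, every integrable `g`, and all
`ν`-separated intervals `I = [i/k, (i+1)/k]`, `I' = [i'/k, (i'+1)/k]` of the partition
`P_ν([0,1])`,
`Avg_{Δ ∈ P_{ν^{-b}}(B)} Π (Σ_{J ∈ P_{ν^b}} ‖E_J g‖_{L²_#(w̃_Δ)}²)^{p/4}
  ≤ M^p Π (Σ_{J ∈ P_δ} ‖E_J g‖_{L^p_#(w_B)}²)^{p/4}`. -/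
def BilIneq (p : ℝ) (n k b : ℕ) (M : ℝ) : Prop :=
  ∀ g : ℝ → ℂ, IntegrableOn g (Set.Icc 0 1) → ∀ c : ℝ × ℝ,
    ∀ i i' : ℕ, i < k → i' < k → (i + 1 < i' ∨ i' + 1 < i) →
    (((n ^ 2 / k ^ b : ℕ) : ℝ) ^ 2)⁻¹ *
        ∑ a ∈ Finset.range (n ^ 2 / k ^ b), ∑ a' ∈ Finset.range (n ^ 2 / k ^ b),
          ((∑ J ∈ Finset.range (k ^ (b - 1)),
              shLp 2 ((k : ℝ) ^ b)
                (wtB (subCtr c ((n : ℝ) ^ 2) ((k : ℝ) ^ b) a a') ((k : ℝ) ^ b))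
                (extOp ((i : ℝ) / (k : ℝ) + (J : ℝ) / (k : ℝ) ^ b)
                  ((i : ℝ) / (k : ℝ) + ((J : ℝ) + 1) / (k : ℝ) ^ b) g) ^ 2) ^ (p / 4) *
            (∑ J ∈ Finset.range (k ^ (b - 1)),
              shLp 2 ((k : ℝ) ^ b)
                (wtB (subCtr c ((n : ℝ) ^ 2) ((k : ℝ) ^ b) a a') ((k : ℝ) ^ b))
                (extOp ((i' : ℝ) / (k : ℝ) + (J : ℝ) / (k : ℝ) ^ b)
                  ((i' : ℝ) / (k : ℝ) + ((J : ℝ) + 1) / (k : ℝ) ^ b) g) ^ 2) ^ (p / 4))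
      ≤ M ^ p *
        ((∑ J ∈ Finset.range (n / k),
            shLp p ((n : ℝ) ^ 2) (wB c ((n : ℝ) ^ 2))
              (extOp ((i : ℝ) / (k : ℝ) + (J : ℝ) / (n : ℝ))
                ((i : ℝ) / (k : ℝ) + ((J : ℝ) + 1) / (n : ℝ)) g) ^ 2) ^ (p / 4) *
          (∑ J ∈ Finset.range (n / k),
            shLp p ((n : ℝ) ^ 2) (wB c ((n : ℝ) ^ 2))
              (extOp ((i' : ℝ) / (k : ℝ) + (J : ℝ) / (n : ℝ))
                ((i' : ℝ) / (k : ℝ) + ((J : ℝ) + 1) / (n : ℝ)) g) ^ 2) ^ (p / 4))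

/-- The bilinear decoupling constant `M_{p,b}(δ, ν)` with `δ = 1/n`, `ν = 1/k`. -/
def Mconst (p : ℝ) (n k b : ℕ) : ℝ := sInf {M : ℝ | 0 ≤ M ∧ BilIneq p n k b M}

/-- The Fourier transform of a function on `ℝ²`. -/
def ftR2 (η : ℝ × ℝ → ℝ) (ξ : ℝ × ℝ) : ℂ :=
  ∫ x : ℝ × ℝ, (η x : ℂ) * Complex.exp (-(2 * Real.pi * Complex.I) * ((x.1 * ξ.1 + x.2 * ξ.2 : ℝ) : ℂ))

end

open scoped SchwartzMap FourierTransform in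
/-- There is a kernel with decay `(1 + |s|)^{-202}` whose Fourier transform is `1` on `[0, 1]`. -/
lemma exists_reproducing_kernel : ∃ (ψ : ℝ → ℂ) (A : ℝ), Continuous ψ ∧ 0 ≤ A ∧
    (∀ s, ‖ψ s‖ ≤ A * ((1 + |s|) ^ 202)⁻¹) ∧
    ∀ τ ∈ Set.Icc (0 : ℝ) 1,
      ∫ s : ℝ, Complex.exp (2 * Real.pi * Complex.I * ((τ * s : ℝ) : ℂ)) * ψ s = 1 := by
  let β : ContDiffBump (0 : ℝ) := ⟨2, 3, by norm_num, by norm_num⟩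
  let f : ℝ → ℂ := fun x => (β x : ℂ)
  have hf1 : HasCompactSupport f := β.hasCompactSupport.comp_left (g := Complex.ofReal) rfl
  have hf2 : ContDiff ℝ (⊤ : ℕ∞) f := Complex.ofRealCLM.contDiff.comp β.contDiff
  let F : 𝓢(ℝ, ℂ) := hf1.toSchwartzMap hf2
  let ψ : 𝓢(ℝ, ℂ) := 𝓕 F
  have hdecay : ∀ k : ℕ, ∃ A : ℝ, ∀ s, (1 + |s|) ^ k * ‖ψ s‖ ≤ A := fun k =>
    ⟨_, fun s => by
      have := SchwartzMap.one_add_le_sup_seminorm_apply (𝕜 := ℝ) (m := (k, 0)) (k := k) (n := 0)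
        le_rfl le_rfl ψ s
      rw [norm_iteratedFDeriv_zero, Real.norm_eq_abs] at this
      exact this⟩
  obtain ⟨A, hA⟩ := hdecay 202
  refine ⟨ψ, A, ψ.continuous,
    (by positivity : 0 ≤ (1 + |(0 : ℝ)|) ^ 202 * ‖ψ 0‖).trans (hA 0), fun s => ?_, fun τ hτ => ?_⟩
  · rw [← div_eq_mul_inv, le_div_iff₀ (by positivity), mul_comm]
    exact hA s
  · have h1 : (𝓕⁻ ψ) τ = F τ := by simp [ψ]
    rw [SchwartzMap.fourierInv_coe, Real.fourierInv_eq'] at h1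
    have h2 : F τ = 1 := by
      have : β τ = 1 := β.one_of_mem_closedBall (by
        rw [mem_closedBall_zero_iff, Real.norm_eq_abs, abs_of_nonneg hτ.1]
        exact hτ.2.trans (by norm_num [β]))
      change ((β τ : ℝ) : ℂ) = 1
      rw [this]; simp
    rw [h2] at h1
    rw [← h1]
    refine integral_congr_ae (Filter.Eventually.of_forall fun s => ?_)
    simp only [smul_eq_mul]
    congr 2
    simp
    ring

/-- Hölder's inequality in the form `(∫ φ κ)^q ≤ (∫ κ)^{q-1} ∫ φ^q κ`. -/
lemma rpow_lintegral_mul_le {φ κ : ℝ → ENNReal} (hφ : Measurable φ) (hκ : Measurable κ) {q : ℝ}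
    (hq : 1 < q) :
    (∫⁻ s, φ s * κ s) ^ q ≤ (∫⁻ s, κ s) ^ (q - 1) * ∫⁻ s, φ s ^ q * κ s := by
  have hpq := Real.HolderConjugate.conjExponent hq
  have h := ENNReal.lintegral_mul_le_Lp_mul_Lq (volume.withDensity κ) hpq hφ.aemeasurable
    (aemeasurable_const (b := (1 : ENNReal)))
  simp only [Pi.mul_apply, mul_one, ENNReal.one_rpow, lintegral_one,
    withDensity_apply _ MeasurableSet.univ, Measure.restrict_univ] at h
  rw [lintegral_withDensity_eq_lintegral_mul _ hκ hφ,
    lintegral_withDensity_eq_lintegral_mul _ hκ (hφ.pow_const q)] at h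
  simp only [Pi.mul_apply] at h
  have hq0 : 0 < q := by linarith
  have h2 := ENNReal.rpow_le_rpow h hq0.le
  rw [ENNReal.mul_rpow_of_nonneg _ _ hq0.le, ← ENNReal.rpow_mul, ← ENNReal.rpow_mul,
    one_div_mul_cancel hq0.ne', ENNReal.rpow_one] at h2
  have e : 1 / q.conjExponent * q = q - 1 := by
    unfold Real.conjExponent
    have : q - 1 ≠ 0 := by linarith
    field_simp
  rw [e] at h2
  simp only [mul_comm (φ _), mul_comm (φ _ ^ q)]
  rw [mul_comm]
  exact h2

lemma lintegral_inv_one_add_abs_pow_ne_top {n : ℕ} (hn : 2 ≤ n) :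
    ∫⁻ s : ℝ, ENNReal.ofReal ((1 + |s|) ^ n)⁻¹ ≠ ⊤ := by
  have h : Integrable fun s : ℝ => (1 + ‖s‖) ^ (-(n : ℝ)) := integrable_one_add_norm (by
    simp only [Module.finrank_self]; exact_mod_cast (by omega : 1 < n))
  convert h.lintegral_lt_top.ne using 4 with s
  rw [Real.rpow_neg (by positivity), Real.rpow_natCast, Real.norm_eq_abs]

lemma norm_exp_two_pi_I_mul (t : ℝ) : ‖Complex.exp (2 * Real.pi * Complex.I * (t : ℂ))‖ = 1 := by
  rw [← Complex.norm_exp_ofReal_mul_I (2 * Real.pi * t)]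
  congr 2
  push_cast
  ring

lemma continuous_extOp {a b : ℝ} {g : ℝ → ℂ} (hg : IntegrableOn g (Set.Icc a b)) :
    Continuous (extOp a b g) := by
  refine continuous_of_dominated (bound := fun ξ => ‖g ξ‖) (fun x => ?_) (fun x => ?_) hg.norm ?_
  · exact hg.aestronglyMeasurable.mul (by fun_prop)
  · exact Filter.Eventually.of_forall fun ξ => by rw [norm_mul, norm_exp_two_pi_I_mul, mul_one]
  · exact Filter.Eventually.of_forall fun ξ => by fun_prop

lemma norm_extOp_le (a b : ℝ) (g : ℝ → ℂ) (x : ℝ × ℝ) :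
    ‖extOp a b g x‖ ≤ ∫ ξ in Set.Icc a b, ‖g ξ‖ := by
  refine (norm_integral_le_integral_norm _).trans_eq ?_
  simp only [norm_mul, norm_exp_two_pi_I_mul, mul_one]

/-- Reproducing formula along the direction normal to the parabola at the left endpoint. -/
lemma extOp_eq_integral {ψ : ℝ → ℂ} (hψ : Integrable ψ)
    (hψ1 : ∀ τ ∈ Set.Icc (0 : ℝ) 1,
      ∫ s : ℝ, Complex.exp (2 * Real.pi * Complex.I * ((τ * s : ℝ) : ℂ)) * ψ s = 1)
    {a b ρ : ℝ} (hρ : 0 ≤ ρ) (hab : (b - a) ^ 2 * ρ ≤ 1) {g : ℝ → ℂ}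
    (hg : IntegrableOn g (Set.Icc a b)) (x : ℝ × ℝ) :
    extOp a b g x = ∫ s : ℝ, Complex.exp (2 * Real.pi * Complex.I * ((a ^ 2 * ρ * s : ℝ) : ℂ)) *
      extOp a b g (x.1 - 2 * a * ρ * s, x.2 + ρ * s) * ψ s := by
  let h : ℝ → ℂ := fun ξ =>
    g ξ * Complex.exp (2 * Real.pi * Complex.I * ((ξ * x.1 + ξ ^ 2 * x.2 : ℝ) : ℂ))
  let E : ℝ → ℝ → ℂ := fun ξ s =>
    Complex.exp (2 * Real.pi * Complex.I * (((ξ - a) ^ 2 * ρ * s : ℝ) : ℂ))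
  have hh : Integrable h (volume.restrict (Set.Icc a b)) := by
    refine (hg.norm).mono' (hg.aestronglyMeasurable.mul (by fun_prop)) ?_
    exact Filter.Eventually.of_forall fun ξ => by
      simp only [h]; rw [norm_mul, norm_exp_two_pi_I_mul, mul_one]
  have hint : Integrable (Function.uncurry fun ξ s => E ξ s * (h ξ * ψ s))
      ((volume.restrict (Set.Icc a b)).prod volume) := by
    refine (hh.mul_prod hψ).bdd_mul (c := 1) (f := fun z : ℝ × ℝ => E z.1 z.2) ?_ ?_
    · exact (by fun_prop : Continuous fun z : ℝ × ℝ => E z.1 z.2).aestronglyMeasurable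
    · exact Filter.Eventually.of_forall fun z => (norm_exp_two_pi_I_mul _).le
  have h1 : extOp a b g x = ∫ ξ in Set.Icc a b, ∫ s, E ξ s * (h ξ * ψ s) := by
    refine setIntegral_congr_fun measurableSet_Icc fun ξ hξ => ?_
    have hmem : (ξ - a) ^ 2 * ρ ∈ Set.Icc (0 : ℝ) 1 := by
      refine ⟨by positivity, le_trans ?_ hab⟩
      have := hξ.1
      have := hξ.2
      gcongr
    have : ∀ s, E ξ s * (h ξ * ψ s) = h ξ * (E ξ s * ψ s) := fun s => by ring
    simp only [this, integral_const_mul]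
    rw [hψ1 _ hmem, mul_one]
  rw [h1, integral_integral_swap hint]
  refine integral_congr_ae (Filter.Eventually.of_forall fun s => ?_)
  simp only [extOp]
  rw [← integral_const_mul, ← integral_mul_const]
  refine integral_congr_ae (Filter.Eventually.of_forall fun ξ => ?_)
  have e : E ξ s * Complex.exp (2 * Real.pi * Complex.I * ((ξ * x.1 + ξ ^ 2 * x.2 : ℝ) : ℂ)) =
      Complex.exp (2 * Real.pi * Complex.I * ((a ^ 2 * ρ * s : ℝ) : ℂ)) *
        Complex.exp (2 * Real.pi * Complex.I * ((ξ * (x.1 - 2 * a * ρ * s) +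
          ξ ^ 2 * (x.2 + ρ * s) : ℝ) : ℂ)) := by
    simp only [E]
    rw [← Complex.exp_add, ← Complex.exp_add]
    congr 1
    push_cast
    ring
  simp only [h]
  linear_combination (g ξ * ψ s) * e

/-- Local constancy of `|E_J g|^q` along the long direction of the dual tube of `J`. -/
lemma exists_extOp_rpow_le : ∃ A : ℝ, 1 ≤ A ∧ ∀ {q a b ρ : ℝ}, 1 < q → 0 ≤ ρ →
    (b - a) ^ 2 * ρ ≤ 1 → ∀ {g : ℝ → ℂ}, IntegrableOn g (Set.Icc a b) → ∀ x : ℝ × ℝ,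
    ‖extOp a b g x‖ₑ ^ q ≤ ENNReal.ofReal (A ^ q) *
      ∫⁻ s : ℝ, ‖extOp a b g (x.1 - 2 * a * ρ * s, x.2 + ρ * s)‖ₑ ^ q *
        ENNReal.ofReal ((1 + |s|) ^ 202)⁻¹ := by
  obtain ⟨ψ, A, hψc, hA0, hψ, hψ1⟩ := exists_reproducing_kernel
  set κ : ℝ → ENNReal := fun s => ENNReal.ofReal ((1 + |s|) ^ 202)⁻¹ with hκ
  have hκm : Measurable κ := by fun_prop
  have hκt : ∫⁻ s, κ s ≠ ⊤ := lintegral_inv_one_add_abs_pow_ne_top (by norm_num)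
  have hκi : Integrable fun s : ℝ => ((1 + |s|) ^ 202)⁻¹ :=
    (lintegral_ofReal_ne_top_iff_integrable (by fun_prop)
      (Filter.Eventually.of_forall fun s => by positivity)).1 hκt
  have hψi : Integrable ψ :=
    (hκi.const_mul A).mono' hψc.aestronglyMeasurable (Filter.Eventually.of_forall hψ)
  set B : ℝ := max 1 (∫⁻ s, κ s).toReal
  have hB : ∫⁻ s, κ s ≤ ENNReal.ofReal B := by
    rw [← ENNReal.ofReal_toReal hκt]
    exact ENNReal.ofReal_le_ofReal (le_max_right _ _)
  have hB1 : 1 ≤ B := le_max_left _ _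
  refine ⟨max 1 A * B, one_le_mul_of_one_le_of_one_le (le_max_left _ _) hB1, ?_⟩
  intro q a b ρ hq hρ hab g hg x
  set φ : ℝ → ENNReal := fun s => ‖extOp a b g (x.1 - 2 * a * ρ * s, x.2 + ρ * s)‖ₑ with hφ
  have hφm : Measurable φ := by
    have := (continuous_extOp hg).comp
      (by fun_prop : Continuous fun s : ℝ => (x.1 - 2 * a * ρ * s, x.2 + ρ * s))
    exact this.enorm.measurable
  have h1 : ‖extOp a b g x‖ₑ ≤ ENNReal.ofReal A * ∫⁻ s, φ s * κ s := by
    rw [extOp_eq_integral hψi hψ1 hρ hab hg x, ← lintegral_const_mul' _ _ ENNReal.ofReal_ne_top]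
    refine (enorm_integral_le_lintegral_enorm _).trans (lintegral_mono fun s => ?_)
    rw [enorm_mul, enorm_mul]
    have e1 : ‖Complex.exp (2 * Real.pi * Complex.I * ((a ^ 2 * ρ * s : ℝ) : ℂ))‖ₑ = 1 := by
      rw [← ofReal_norm, norm_exp_two_pi_I_mul, ENNReal.ofReal_one]
    have e2 : ‖ψ s‖ₑ ≤ ENNReal.ofReal A * κ s := by
      rw [← ofReal_norm, hκ, ← ENNReal.ofReal_mul hA0]
      exact ENNReal.ofReal_le_ofReal (hψ s)
    rw [e1, one_mul]
    calc φ s * ‖ψ s‖ₑ ≤ φ s * (ENNReal.ofReal A * κ s) := by gcongr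
      _ = _ := by ring
  have hq0 : 0 < q := by linarith
  calc ‖extOp a b g x‖ₑ ^ q ≤ (ENNReal.ofReal A * ∫⁻ s, φ s * κ s) ^ q := by gcongr
    _ = ENNReal.ofReal A ^ q * (∫⁻ s, φ s * κ s) ^ q := ENNReal.mul_rpow_of_nonneg _ _ hq0.le
    _ ≤ ENNReal.ofReal A ^ q * ((∫⁻ s, κ s) ^ (q - 1) * ∫⁻ s, φ s ^ q * κ s) := by
      gcongr; exact rpow_lintegral_mul_le hφm hκm hq
    _ ≤ ENNReal.ofReal (max 1 A) ^ q * (ENNReal.ofReal B ^ q * ∫⁻ s, φ s ^ q * κ s) := by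
      gcongr
      · exact le_max_right _ _
      · calc (∫⁻ s, κ s) ^ (q - 1) ≤ ENNReal.ofReal B ^ (q - 1) :=
            ENNReal.rpow_le_rpow hB (by linarith)
          _ ≤ ENNReal.ofReal B ^ q := ENNReal.rpow_le_rpow_of_exponent_le
            (by simpa using hB1) (by linarith)
    _ = _ := by
      rw [← mul_assoc, ← ENNReal.mul_rpow_of_nonneg _ _ hq0.le,
        ← ENNReal.ofReal_mul (by positivity), ENNReal.ofReal_rpow_of_nonneg (by positivity) hq0.le]

/-- The decay profile at scale `r` used transversally to a tube. -/
noncomputable def tailWt (r t : ℝ) : ℝ := ((1 + t) ^ 2)⁻¹ + (r ^ 2)⁻¹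

lemma tailWt_nonneg (r t : ℝ) : 0 ≤ tailWt r t := by
  unfold tailWt
  positivity

lemma inv_pow_mul_inv_pow_le_tailWt {r α β t : ℝ} (hr : 1 ≤ r) (hα : 0 ≤ α) (hβ : 0 ≤ β)
    (ht : 0 ≤ t) (htαβ : t ≤ α + 2 * β) :
    ((1 + α) ^ 100)⁻¹ * ((1 + β) ^ 100)⁻¹ ≤
      36 * (((1 + α / r) * (1 + β / r)) ^ 100)⁻¹ * tailWt r t * tailWt r β := by
  have hr0 : 0 < r := by linarith
  have key : ∀ γ : ℝ, 0 ≤ γ → 0 ≤ (1 + γ / r) / (1 + γ) ∧ (1 + γ / r) / (1 + γ) ≤ 1 ∧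
      (1 + γ / r) / (1 + γ) ≤ (1 + γ)⁻¹ + r⁻¹ := by
    intro γ hγ
    have hγr : γ / r ≤ γ := div_le_self hγ hr
    refine ⟨by positivity, by rw [div_le_one (by positivity)]; linarith, ?_⟩
    rw [add_div, one_div]
    gcongr
    rw [div_le_iff₀ (by positivity), div_eq_mul_inv, mul_comm]
    gcongr
    linarith
  obtain ⟨hm0, hm1, hm⟩ := key α hα
  obtain ⟨hn0, hn1, hn⟩ := key β hβ
  set m := (1 + α / r) / (1 + α) with hmdef
  set n := (1 + β / r) / (1 + β) with hndef
  have hz0 : 0 ≤ r⁻¹ := by positivity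
  have hz1 : r⁻¹ ≤ 1 := inv_le_one_of_one_le₀ hr
  have hx0 : 0 ≤ (1 + α)⁻¹ := by positivity
  have hx1 : (1 + α)⁻¹ ≤ 1 := inv_le_one_of_one_le₀ (by linarith)
  have hy0 : 0 ≤ (1 + β)⁻¹ := by positivity
  have hy1 : (1 + β)⁻¹ ≤ 1 := inv_le_one_of_one_le₀ (by linarith)
  have hw0 : 0 ≤ (1 + t)⁻¹ := by positivity
  have hxy : (1 + α)⁻¹ * (1 + β)⁻¹ ≤ 2 * (1 + t)⁻¹ := by
    rw [← mul_inv, ← div_eq_mul_inv, inv_eq_one_div, div_le_div_iff₀ (by positivity) (by positivity)]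
    nlinarith [mul_nonneg hα hβ]
  have htail : ∀ γ : ℝ, ((1 + γ)⁻¹ + r⁻¹) ^ 2 ≤ 2 * tailWt r γ := by
    intro γ
    unfold tailWt
    rw [← inv_pow, ← inv_pow]
    nlinarith [sq_nonneg ((1 + γ)⁻¹ - r⁻¹)]
  have hmn : m * n ≤ 3 * ((1 + t)⁻¹ + r⁻¹) := by
    have : m * n ≤ ((1 + α)⁻¹ + r⁻¹) * ((1 + β)⁻¹ + r⁻¹) := by gcongr
    nlinarith [mul_le_mul_of_nonneg_right hx1 hz0, mul_le_mul_of_nonneg_right hy1 hz0,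
      mul_le_mul_of_nonneg_right hz1 hz0]
  have h1 : (m * n) ^ 2 ≤ 18 * tailWt r t := by
    have : (m * n) ^ 2 ≤ (3 * ((1 + t)⁻¹ + r⁻¹)) ^ 2 := by gcongr
    nlinarith [htail t]
  have h2 : n ^ 2 ≤ 2 * tailWt r β := (by gcongr : n ^ 2 ≤ ((1 + β)⁻¹ + r⁻¹) ^ 2).trans (htail β)
  have h3 : (m * n) ^ 100 ≤ 36 * tailWt r t * tailWt r β := by
    calc (m * n) ^ 100 ≤ (m * n) ^ 4 :=
          pow_le_pow_of_le_one (by positivity) (mul_le_one₀ hm1 hn0 hn1) (by norm_num)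
      _ = (m * n) ^ 2 * n ^ 2 * m ^ 2 := by ring
      _ ≤ (m * n) ^ 2 * n ^ 2 * 1 := by gcongr; exact pow_le_one₀ hm0 hm1
      _ ≤ 18 * tailWt r t * (2 * tailWt r β) * 1 := by
        gcongr
        exact mul_nonneg (by norm_num) (tailWt_nonneg _ _)
      _ = _ := by ring
  have e : ((1 + α) ^ 100)⁻¹ * ((1 + β) ^ 100)⁻¹ =
      (((1 + α / r) * (1 + β / r)) ^ 100)⁻¹ * (m * n) ^ 100 := by
    have hb : (1 + α)⁻¹ * (1 + β)⁻¹ = ((1 + α / r) * (1 + β / r))⁻¹ * (m * n) := by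
      rw [hmdef, hndef]
      field_simp
    rw [← inv_pow, ← inv_pow, ← mul_pow, hb, mul_pow, inv_pow]
  rw [e]
  calc _ ≤ (((1 + α / r) * (1 + β / r)) ^ 100)⁻¹ * (36 * tailWt r t * tailWt r β) := by gcongr
    _ = _ := by ac_rfl

lemma one_add_mul_one_add_le {c a z : ℝ × ℝ} {r ξ s : ℝ} (hr : 1 ≤ r) (hξ0 : 0 ≤ ξ) (hξ1 : ξ ≤ 1)
    (h1 : |a.1 - c.1| ≤ r ^ 2 / 2) (h2 : |a.2 - c.2| ≤ r ^ 2 / 2) :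
    (1 + |z.1 - c.1| / r ^ 2) * (1 + |z.2 - c.2| / r ^ 2) ≤
      4 * ((1 + |z.1 + 2 * ξ * r ^ 2 * s - a.1| / r / r) *
        (1 + |z.2 - r ^ 2 * s - a.2| / r / r) * (1 + |s|) ^ 2) := by
  have hr0 : 0 < r := by linarith
  set X := z.1 + 2 * ξ * r ^ 2 * s - a.1 with hX
  set Y := z.2 - r ^ 2 * s - a.2 with hY
  have hz1 : |z.1 - c.1| ≤ |X| + 2 * (r ^ 2 * |s|) + r ^ 2 / 2 := by
    have e : z.1 - c.1 = X + -(2 * ξ * r ^ 2 * s) + (a.1 - c.1) := by rw [hX]; ring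
    rw [e]
    refine (abs_add_three _ _ _).trans ?_
    have : |-(2 * ξ * r ^ 2 * s)| ≤ 2 * (r ^ 2 * |s|) := by
      rw [abs_neg, abs_mul, abs_of_nonneg (by positivity : 0 ≤ 2 * ξ * r ^ 2)]
      nlinarith [mul_le_mul_of_nonneg_right hξ1 (by positivity : 0 ≤ r ^ 2 * |s|)]
    linarith
  have hz2 : |z.2 - c.2| ≤ |Y| + 2 * (r ^ 2 * |s|) + r ^ 2 / 2 := by
    have e : z.2 - c.2 = Y + r ^ 2 * s + (a.2 - c.2) := by rw [hY]; ring
    rw [e]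
    refine (abs_add_three _ _ _).trans ?_
    have : |r ^ 2 * s| = r ^ 2 * |s| := by rw [abs_mul, abs_of_nonneg (by positivity)]
    have : 0 ≤ r ^ 2 * |s| := by positivity
    linarith
  have hcoord : ∀ {w x : ℝ}, w ≤ |x| + 2 * (r ^ 2 * |s|) + r ^ 2 / 2 →
      1 + w / r ^ 2 ≤ 2 * ((1 + |x| / r / r) * (1 + |s|)) := by
    intro w x hw
    have hdiv : w / r ^ 2 ≤ |x| / r / r + 2 * |s| + 1 / 2 := by
      rw [div_le_iff₀ (by positivity)]
      have : (|x| / r / r + 2 * |s| + 1 / 2) * r ^ 2 = |x| + 2 * (r ^ 2 * |s|) + r ^ 2 / 2 := by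
        field_simp
      rw [this]
      exact hw
    have hA : 0 ≤ |x| / r / r := by positivity
    nlinarith [mul_nonneg hA (abs_nonneg s)]
  calc _ ≤ 2 * ((1 + |X| / r / r) * (1 + |s|)) * (2 * ((1 + |Y| / r / r) * (1 + |s|))) := by
        gcongr
        · exact hcoord hz1
        · exact hcoord hz2
    _ = _ := by ring

lemma inv_one_add_abs_sub_div_pow_le {r u v y : ℝ} (hr : 0 < r) (h : |u - v| ≤ r / 2) :
    ((1 + |y - u| / r) ^ 100)⁻¹ ≤ 2 ^ 100 * ((1 + |y - v| / r) ^ 100)⁻¹ := by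
  have h0 : |y - v| ≤ |y - u| + r / 2 := by
    have := abs_add_le (y - u) (u - v)
    rw [sub_add_sub_cancel] at this
    linarith
  have h1 : 1 + |y - v| / r ≤ 2 * (1 + |y - u| / r) := by
    have : |y - v| / r ≤ (|y - u| + r / 2) / r := by gcongr
    rw [add_div, div_right_comm, div_self hr.ne'] at this
    have := div_nonneg (abs_nonneg (y - u)) hr.le
    linarith
  rw [← div_eq_mul_inv, ← one_div, div_le_div_iff₀ (by positivity) (by positivity), one_mul,
    ← mul_pow]
  gcongr

lemma exists_wtB_mul_le : ∃ K : ℝ, 0 < K ∧ ∀ {c d a z : ℝ × ℝ} {r ξ s : ℝ}, 1 ≤ r → 0 ≤ ξ → ξ ≤ 1 →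
    |a.1 - c.1| ≤ r ^ 2 / 2 → |a.2 - c.2| ≤ r ^ 2 / 2 →
    |d.1 - a.1| ≤ r / 2 → |d.2 - a.2| ≤ r / 2 →
    wtB d r (z.1 + 2 * ξ * r ^ 2 * s, z.2 - r ^ 2 * s) * ((1 + |s|) ^ 202)⁻¹ ≤
      K * (wtB c (r ^ 2) z * tailWt r (|z.1 + 2 * ξ * z.2 - (a.1 + 2 * ξ * a.2)| / r)) *
        (((1 + |z.2 - r ^ 2 * s - a.2| / r) ^ 2)⁻¹ + (r ^ 2)⁻¹ * ((1 + |s|) ^ 2)⁻¹) := by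
  refine ⟨2 ^ 100 * 2 ^ 100 * 36 * 4 ^ 100, by positivity, ?_⟩
  generalize hK2 : (2 : ℝ) ^ 100 = K2
  generalize hK4 : (4 : ℝ) ^ 100 = K4
  have hK20 : 0 < K2 := by rw [← hK2]; positivity
  have hK40 : 0 < K4 := by rw [← hK4]; positivity
  intro c d a z r ξ s hr hξ0 hξ1 h1 h2 h3 h4
  have hr0 : 0 < r := by linarith
  have hlow := one_add_mul_one_add_le (z := z) (s := s) hr hξ0 hξ1 h1 h2
  have hz : ∀ x : ℝ, x ^ (-100 : ℤ) = (x ^ 100)⁻¹ := fun x => by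
    rw [zpow_neg]; norm_cast
  have hs1 := inv_one_add_abs_sub_div_pow_le (y := z.1 + 2 * ξ * r ^ 2 * s) hr0 h3
  have hs2 := inv_one_add_abs_sub_div_pow_le (y := z.2 - r ^ 2 * s) hr0 h4
  rw [hK2] at hs1 hs2
  set α := |z.1 + 2 * ξ * r ^ 2 * s - a.1| / r with hα
  set β := |z.2 - r ^ 2 * s - a.2| / r with hβ
  set t := |z.1 + 2 * ξ * z.2 - (a.1 + 2 * ξ * a.2)| / r with ht
  have hα0 : 0 ≤ α := by positivity
  have hβ0 : 0 ≤ β := by positivity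
  have htαβ : t ≤ α + 2 * β := by
    rw [ht, hα, hβ, ← mul_div_assoc, ← add_div]
    gcongr
    have e : z.1 + 2 * ξ * z.2 - (a.1 + 2 * ξ * a.2) = (z.1 + 2 * ξ * r ^ 2 * s - a.1) +
      2 * ξ * (z.2 - r ^ 2 * s - a.2) := by ring
    rw [e]
    refine (abs_add_le _ _).trans ?_
    rw [abs_mul, abs_of_nonneg (by positivity : 0 ≤ 2 * ξ)]
    gcongr
    linarith
  have hsplit := inv_pow_mul_inv_pow_le_tailWt hr hα0 hβ0 (by positivity : 0 ≤ t) htαβ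
  have hT := tailWt_nonneg r t
  have hTβ := tailWt_nonneg r β
  have hw : (((1 + α / r) * (1 + β / r)) ^ 100)⁻¹ * ((1 + |s|) ^ (2 * 100))⁻¹ ≤
      K4 * wtB c (r ^ 2) z := by
    rw [wtB, hz, hz, pow_mul _ 2 100, ← mul_inv, ← mul_inv, ← mul_pow, ← mul_pow, ← div_eq_mul_inv,
      ← one_div, ← hK4, div_le_div_iff₀ (by positivity) (by positivity), one_mul, ← mul_pow]
    gcongr
  have hw0 : 0 ≤ wtB c (r ^ 2) z := by unfold wtB; positivity
  have hlast : tailWt r β * ((1 + |s|) ^ 2)⁻¹ ≤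
      ((1 + β) ^ 2)⁻¹ + (r ^ 2)⁻¹ * ((1 + |s|) ^ 2)⁻¹ := by
    have : ((1 + |s|) ^ 2)⁻¹ ≤ 1 :=
      inv_le_one_of_one_le₀ (one_le_pow₀ (by linarith [abs_nonneg s]))
    rw [tailWt, add_mul]
    gcongr
    exact mul_le_of_le_one_right (by positivity) this
  have hpow : ((1 + |s|) ^ 202)⁻¹ = ((1 + |s|) ^ (2 * 100))⁻¹ * ((1 + |s|) ^ 2)⁻¹ := by
    rw [← mul_inv, ← pow_add]
  generalize (((1 + α / r) * (1 + β / r)) ^ 100)⁻¹ = P at hw hsplit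
  generalize ((1 + |s|) ^ (2 * 100))⁻¹ = S at hw hpow
  generalize hW : wtB c (r ^ 2) z = W at hw hw0
  have hS2 : 0 ≤ ((1 + |s|) ^ 202)⁻¹ := by positivity
  generalize ((1 + |s|) ^ 202)⁻¹ = S2 at hS2 hpow
  generalize tailWt r t = T at hT hsplit
  calc wtB d r (z.1 + 2 * ξ * r ^ 2 * s, z.2 - r ^ 2 * s) * S2
      ≤ (K2 * ((1 + α) ^ 100)⁻¹) * (K2 * ((1 + β) ^ 100)⁻¹) * S2 := by
        rw [wtB, hz, hz]
        gcongr
    _ = K2 * K2 * (((1 + α) ^ 100)⁻¹ * ((1 + β) ^ 100)⁻¹) * S2 := by ac_rfl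
    _ ≤ K2 * K2 * (36 * P * T * tailWt r β) *
          S2 := by gcongr
    _ = K2 * K2 * 36 * (P * S) *
          T * (tailWt r β * ((1 + |s|) ^ 2)⁻¹) := by rw [hpow]; ac_rfl
    _ ≤ K2 * K2 * 36 * (K4 * W) * T *
          (((1 + β) ^ 2)⁻¹ + (r ^ 2)⁻¹ * ((1 + |s|) ^ 2)⁻¹) :=
        mul_le_mul (mul_le_mul_of_nonneg_right (mul_le_mul_of_nonneg_left hw (by positivity)) hT)
          hlast (by positivity) (by positivity)
    _ = _ := by ac_rfl

lemma lintegral_comp_mul_add (F : ℝ → ENNReal) (hF : Measurable F) {κ : ℝ} (hκ : κ ≠ 0) (y : ℝ) :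
    ∫⁻ s, F (κ * s + y) = ENNReal.ofReal |κ⁻¹| * ∫⁻ s, F s := by
  have h1 : ∫⁻ s, F (κ * s + y) = ∫⁻ s, F (s + y) ∂(Measure.map (κ * ·) volume) := by
    rw [lintegral_map (by fun_prop) (by fun_prop)]
  rw [h1, Real.map_volume_mul_left hκ, lintegral_smul_measure, lintegral_add_right_eq_self,
    smul_eq_mul]

/-- The linear change of variables behind the bilinear Kakeya estimate. -/
lemma lintegral_transversal {V V' : ℝ → ENNReal} (hV : Measurable V) (hV' : Measurable V')
    {ξ ξ' : ℝ} (h : ξ ≠ ξ') :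
    ∫⁻ a : ℝ × ℝ, V (a.1 + 2 * ξ * a.2) * V' (a.1 + 2 * ξ' * a.2) =
      ENNReal.ofReal |(2 * (ξ' - ξ))⁻¹| * ((∫⁻ t, V t) * ∫⁻ t, V' t) := by
  have hκ : 2 * (ξ' - ξ) ≠ 0 := by
    intro h0
    exact h (by linarith)
  have hm : Measurable fun a : ℝ × ℝ => V (a.1 + 2 * ξ * a.2) * V' (a.1 + 2 * ξ' * a.2) := by
    fun_prop
  calc ∫⁻ a : ℝ × ℝ, V (a.1 + 2 * ξ * a.2) * V' (a.1 + 2 * ξ' * a.2)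
      = ∫⁻ y, ∫⁻ x, V (x + 2 * ξ * y) * V' (x + 2 * ξ' * y) := by
        rw [Measure.volume_eq_prod, lintegral_prod_symm _ hm.aemeasurable]
    _ = ∫⁻ y, ∫⁻ t, V t * V' (2 * (ξ' - ξ) * y + t) := by
        refine lintegral_congr fun y => ?_
        rw [← lintegral_add_right_eq_self (fun t => V t * V' (2 * (ξ' - ξ) * y + t)) (2 * ξ * y)]
        refine lintegral_congr fun x => ?_
        congr 2
        ring
    _ = ∫⁻ t, ∫⁻ y, V t * V' (2 * (ξ' - ξ) * y + t) :=
        lintegral_lintegral_swap (by fun_prop)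
    _ = ∫⁻ t, V t * (ENNReal.ofReal |(2 * (ξ' - ξ))⁻¹| * ∫⁻ t, V' t) := by
        refine lintegral_congr fun t => ?_
        rw [lintegral_const_mul _ (by fun_prop), lintegral_comp_mul_add _ hV' hκ]
    _ = _ := by
        rw [lintegral_mul_const _ hV]
        ring

/-- The constant `∫ (1 + |s|)^{-2} ds`. -/
noncomputable def tailMass : ℝ := (∫⁻ s : ℝ, ENNReal.ofReal ((1 + |s|) ^ 2)⁻¹).toReal

lemma tailMass_nonneg : 0 ≤ tailMass := ENNReal.toReal_nonneg

lemma ofReal_tailMass :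
    ENNReal.ofReal tailMass = ∫⁻ s : ℝ, ENNReal.ofReal ((1 + |s|) ^ 2)⁻¹ :=
  ENNReal.ofReal_toReal (lintegral_inv_one_add_abs_pow_ne_top le_rfl)

lemma lintegral_longitudinal_le {r : ℝ} (hr : 1 ≤ r) (y : ℝ) :
    ∫⁻ s, ENNReal.ofReal (((1 + |y - r ^ 2 * s| / r) ^ 2)⁻¹ + (r ^ 2)⁻¹ * ((1 + |s|) ^ 2)⁻¹) ≤
      ENNReal.ofReal (2 * tailMass / r) := by
  have hr0 : 0 < r := by linarith
  have h1 : ∫⁻ s, ENNReal.ofReal ((1 + |y - r ^ 2 * s| / r) ^ 2)⁻¹ =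
      ENNReal.ofReal (tailMass / r) := by
    have := lintegral_comp_mul_add (fun s => ENNReal.ofReal ((1 + |s|) ^ 2)⁻¹) (by fun_prop)
      (neg_ne_zero.2 hr0.ne') (y / r)
    rw [← ofReal_tailMass, inv_neg, abs_neg, abs_of_pos (by positivity),
      ← ENNReal.ofReal_mul (by positivity)] at this
    rw [div_eq_inv_mul, ← this]
    refine lintegral_congr fun s => ?_
    congr 4
    rw [← abs_of_pos hr0, ← abs_div, abs_of_pos hr0]
    congr 1
    field_simp
    ring
  have h2 : ∫⁻ s : ℝ, ENNReal.ofReal ((r ^ 2)⁻¹ * ((1 + |s|) ^ 2)⁻¹) ≤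
      ENNReal.ofReal (tailMass / r) := by
    simp_rw [ENNReal.ofReal_mul (by positivity : 0 ≤ (r ^ 2)⁻¹)]
    rw [lintegral_const_mul' _ _ ENNReal.ofReal_ne_top, ← ofReal_tailMass,
      ← ENNReal.ofReal_mul (by positivity), div_eq_inv_mul]
    refine ENNReal.ofReal_le_ofReal (mul_le_mul_of_nonneg_right ?_ tailMass_nonneg)
    gcongr
    nlinarith
  have e : ∀ s, ENNReal.ofReal (((1 + |y - r ^ 2 * s| / r) ^ 2)⁻¹ +
      (r ^ 2)⁻¹ * ((1 + |s|) ^ 2)⁻¹) = ENNReal.ofReal ((1 + |y - r ^ 2 * s| / r) ^ 2)⁻¹ +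
      ENNReal.ofReal ((r ^ 2)⁻¹ * ((1 + |s|) ^ 2)⁻¹) := fun s =>
    ENNReal.ofReal_add (by positivity) (by positivity)
  simp_rw [e]
  rw [lintegral_add_left (by fun_prop), h1]
  have hd : 0 ≤ tailMass / r := div_nonneg tailMass_nonneg hr0.le
  calc _ ≤ ENNReal.ofReal (tailMass / r) + ENNReal.ofReal (tailMass / r) := by gcongr
    _ = _ := by rw [← ENNReal.ofReal_add hd hd]; congr 1; ring

lemma setLIntegral_tailWt_le {r : ℝ} (hr : 1 ≤ r) (y m : ℝ) :
    ∫⁻ t in Set.Icc (m - 3 * r ^ 2 / 2) (m + 3 * r ^ 2 / 2),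
      ENNReal.ofReal (tailWt r (|y - t| / r)) ≤ ENNReal.ofReal ((tailMass + 3) * r) := by
  have hr0 : 0 < r := by linarith
  have h1 : ∫⁻ t, ENNReal.ofReal ((1 + |y - t| / r) ^ 2)⁻¹ = ENNReal.ofReal (tailMass * r) := by
    have := lintegral_comp_mul_add (fun s => ENNReal.ofReal ((1 + |s|) ^ 2)⁻¹) (by fun_prop)
      (neg_ne_zero.2 (inv_ne_zero hr0.ne')) (y / r)
    rw [← ofReal_tailMass, inv_neg, inv_inv, abs_neg, abs_of_pos (by positivity),
      ← ENNReal.ofReal_mul (by positivity)] at this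
    rw [mul_comm, ← this]
    refine lintegral_congr fun s => ?_
    congr 4
    rw [← abs_of_pos hr0, ← abs_div, abs_of_pos hr0]
    congr 1
    field_simp
    ring
  have e : ∀ t, ENNReal.ofReal (tailWt r (|y - t| / r)) =
      ENNReal.ofReal ((1 + |y - t| / r) ^ 2)⁻¹ + ENNReal.ofReal (r ^ 2)⁻¹ := fun t =>
    ENNReal.ofReal_add (by positivity) (by positivity)
  simp_rw [e]
  rw [lintegral_add_right _ measurable_const, lintegral_const, Measure.restrict_apply_univ,
    Real.volume_Icc, ← ENNReal.ofReal_mul (by positivity)]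
  calc _ ≤ ENNReal.ofReal (tailMass * r) + ENNReal.ofReal (3 * r) := by
        refine add_le_add ((setLIntegral_le_lintegral _ _).trans_eq h1) ?_
        refine ENNReal.ofReal_le_ofReal ?_
        have : (r ^ 2)⁻¹ * (m + 3 * r ^ 2 / 2 - (m - 3 * r ^ 2 / 2)) = 3 := by
          field_simp
          ring
        rw [this]
        linarith
    _ = _ := by
        rw [← ENNReal.ofReal_add (mul_nonneg tailMass_nonneg hr0.le) (by positivity), add_mul]

lemma wtB_nonneg (c : ℝ × ℝ) {R : ℝ} (hR : 0 ≤ R) (x : ℝ × ℝ) : 0 ≤ wtB c R x := by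
  unfold wtB
  positivity

lemma measurable_wtB (c : ℝ × ℝ) (R : ℝ) : Measurable (wtB c R) := by
  unfold wtB
  fun_prop

lemma measurable_tailWt (r : ℝ) : Measurable (tailWt r) := by
  unfold tailWt
  fun_prop

set_option maxRecDepth 4000 in
/-- The average over a small square of a function that is locally constant along tubes is
controlled by a function of the transversal coordinate alone. -/
lemma exists_lintegral_wtB_le : ∃ K : ℝ, 0 < K ∧ ∀ {U : ℝ × ℝ → ENNReal} {D : ENNReal}
    {c d a : ℝ × ℝ} {r ξ : ℝ}, Measurable U → D ≠ ⊤ → 1 ≤ r → 0 ≤ ξ → ξ ≤ 1 →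
    (∀ x : ℝ × ℝ, U x ≤ D * ∫⁻ s : ℝ, U (x.1 - 2 * ξ * r ^ 2 * s, x.2 + r ^ 2 * s) *
      ENNReal.ofReal ((1 + |s|) ^ 202)⁻¹) →
    |a.1 - c.1| ≤ r ^ 2 / 2 → |a.2 - c.2| ≤ r ^ 2 / 2 →
    |d.1 - a.1| ≤ r / 2 → |d.2 - a.2| ≤ r / 2 →
    ∫⁻ x, U x * ENNReal.ofReal (wtB d r x) ≤ D * ENNReal.ofReal (K / r) *
      ∫⁻ z, U z * ENNReal.ofReal (wtB c (r ^ 2) z) *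
        ENNReal.ofReal (tailWt r (|z.1 + 2 * ξ * z.2 - (a.1 + 2 * ξ * a.2)| / r)) := by
  obtain ⟨K, hK, hbound⟩ := exists_wtB_mul_le
  refine ⟨K * (2 * (tailMass + 1)), by have := tailMass_nonneg; positivity, ?_⟩
  intro U D c d a r ξ hU hD hr hξ0 hξ1 hloc h1 h2 h3 h4
  have hr0 : 0 < r := by linarith
  have hw := measurable_wtB d r
  have hwtB := measurable_wtB c (r ^ 2)
  have htail := measurable_tailWt r
  set κ : ℝ → ENNReal := fun s => ENNReal.ofReal ((1 + |s|) ^ 202)⁻¹ with hκ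
  have hκm : Measurable κ := by fun_prop
  calc ∫⁻ x, U x * ENNReal.ofReal (wtB d r x)
      ≤ ∫⁻ x : ℝ × ℝ, D * ∫⁻ s : ℝ, U (x.1 - 2 * ξ * r ^ 2 * s, x.2 + r ^ 2 * s) * κ s *
          ENNReal.ofReal (wtB d r x) := by
        refine lintegral_mono fun x => ?_
        rw [lintegral_mul_const _ (by fun_prop), ← mul_assoc]
        gcongr
        exact hloc x
    _ = D * ∫⁻ s : ℝ, ∫⁻ x : ℝ × ℝ, U (x.1 - 2 * ξ * r ^ 2 * s, x.2 + r ^ 2 * s) * κ s *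
          ENNReal.ofReal (wtB d r x) := by
        rw [lintegral_const_mul' _ _ hD, lintegral_lintegral_swap]
        fun_prop
    _ = D * ∫⁻ s : ℝ, ∫⁻ z : ℝ × ℝ, U z * κ s *
          ENNReal.ofReal (wtB d r (z.1 + 2 * ξ * r ^ 2 * s, z.2 - r ^ 2 * s)) := by
        congr 1
        refine lintegral_congr fun s => ?_
        rw [← lintegral_add_right_eq_self (μ := (volume : Measure (ℝ × ℝ))) (fun z => U z * κ s *
          ENNReal.ofReal (wtB d r (z.1 + 2 * ξ * r ^ 2 * s, z.2 - r ^ 2 * s)))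
          (-(2 * ξ * r ^ 2 * s), r ^ 2 * s)]
        refine lintegral_congr fun x => ?_
        simp only [Prod.fst_add, Prod.snd_add, neg_add_cancel_right, add_sub_cancel_right]
        rfl
    _ = D * ∫⁻ z : ℝ × ℝ, ∫⁻ s : ℝ, U z * κ s *
          ENNReal.ofReal (wtB d r (z.1 + 2 * ξ * r ^ 2 * s, z.2 - r ^ 2 * s)) := by
        rw [lintegral_lintegral_swap]
        fun_prop
    _ ≤ D * ∫⁻ z : ℝ × ℝ, ENNReal.ofReal (K * (2 * (tailMass + 1)) / r) *
          (U z * ENNReal.ofReal (wtB c (r ^ 2) z) *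
          ENNReal.ofReal (tailWt r (|z.1 + 2 * ξ * z.2 - (a.1 + 2 * ξ * a.2)| / r))) := by
        gcongr with z
        set Q := wtB c (r ^ 2) z * tailWt r (|z.1 + 2 * ξ * z.2 - (a.1 + 2 * ξ * a.2)| / r) with hQ
        have hwz := wtB_nonneg c (sq_nonneg r) z
        have hQ0 : 0 ≤ Q := mul_nonneg hwz (tailWt_nonneg _ _)
        have hpt : ∀ s, U z * κ s *
            ENNReal.ofReal (wtB d r (z.1 + 2 * ξ * r ^ 2 * s, z.2 - r ^ 2 * s)) ≤
            U z * ENNReal.ofReal (K * Q) * ENNReal.ofReal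
              (((1 + |z.2 - a.2 - r ^ 2 * s| / r) ^ 2)⁻¹ + (r ^ 2)⁻¹ * ((1 + |s|) ^ 2)⁻¹) := by
          intro s
          rw [mul_assoc (U z), mul_assoc (U z), ← ENNReal.ofReal_mul (by positivity),
            ← ENNReal.ofReal_mul (by positivity), mul_comm (((1 + |s|) ^ 202)⁻¹),
            sub_right_comm z.2]
          refine mul_le_mul_right (ENNReal.ofReal_le_ofReal ?_) _
          exact hbound hr hξ0 hξ1 h1 h2 h3 h4
        calc _ ≤ ∫⁻ s, U z * ENNReal.ofReal (K * Q) * ENNReal.ofReal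
              (((1 + |z.2 - a.2 - r ^ 2 * s| / r) ^ 2)⁻¹ + (r ^ 2)⁻¹ * ((1 + |s|) ^ 2)⁻¹) :=
              lintegral_mono hpt
          _ ≤ U z * ENNReal.ofReal (K * Q) * ENNReal.ofReal (2 * tailMass / r) := by
              rw [lintegral_const_mul _ (by fun_prop)]
              gcongr
              exact lintegral_longitudinal_le hr _
          _ ≤ U z * ENNReal.ofReal (K * Q) * ENNReal.ofReal (2 * (tailMass + 1) / r) := by
              gcongr
              linarith
          _ = _ := by
              have := tailMass_nonneg
              rw [mul_assoc (U z), mul_assoc (U z), ← ENNReal.ofReal_mul (by positivity),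
                ← ENNReal.ofReal_mul hwz,
                mul_left_comm (ENNReal.ofReal (_ / r)), ← ENNReal.ofReal_mul (by positivity)]
              congr 2
              rw [← hQ]
              ring
    _ = _ := by
        rw [lintegral_const_mul' _ _ ENNReal.ofReal_ne_top, mul_assoc D]

lemma ofReal_mul_sum_cells_le {r : ℝ} (hr : 0 < r) (N : ℕ) (u v : ℝ) {G : ℕ → ℕ → ENNReal}
    {Φ : ℝ × ℝ → ENNReal} (h : ∀ i < N, ∀ j < N, ∀ a : ℝ × ℝ,
      a.1 ∈ Set.Ico (u + i * r) (u + (i + 1) * r) →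
      a.2 ∈ Set.Ico (v + j * r) (v + (j + 1) * r) → G i j ≤ Φ a) :
    ENNReal.ofReal (r ^ 2) * ∑ i ∈ Finset.range N, ∑ j ∈ Finset.range N, G i j ≤ ∫⁻ a, Φ a := by
  let cell : ℕ × ℕ → Set (ℝ × ℝ) := fun p =>
    Set.Ico (u + p.1 * r) (u + (p.1 + 1) * r) ×ˢ Set.Ico (v + p.2 * r) (v + (p.2 + 1) * r)
  have hcell : ∀ p, MeasurableSet (cell p) := fun p => measurableSet_Ico.prod measurableSet_Ico
  have huniq : ∀ (w x : ℝ) (i j : ℕ), x ∈ Set.Ico (w + i * r) (w + (i + 1) * r) →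
      x ∈ Set.Ico (w + j * r) (w + (j + 1) * r) → i ≤ j := by
    intro w x i j hi hj
    have : (i : ℝ) * r < (j + 1) * r := by linarith [hi.1, hj.2]
    have := lt_of_mul_lt_mul_right this hr.le
    exact_mod_cast Nat.lt_succ_iff.1 (by exact_mod_cast this)
  have hdisj : Set.PairwiseDisjoint
      (↑(Finset.range N ×ˢ Finset.range N) : Set (ℕ × ℕ)) cell := by
    intro p _ p' _ hne
    refine Set.disjoint_left.2 fun a ha ha' => hne ?_
    exact Prod.ext (le_antisymm (huniq _ _ _ _ ha.1 ha'.1) (huniq _ _ _ _ ha'.1 ha.1))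
      (le_antisymm (huniq _ _ _ _ ha.2 ha'.2) (huniq _ _ _ _ ha'.2 ha.2))
  rw [← Finset.sum_product', Finset.mul_sum]
  calc _ ≤ ∑ p ∈ Finset.range N ×ˢ Finset.range N, ∫⁻ a in cell p, Φ a := by
        refine Finset.sum_le_sum fun p hp => ?_
        rw [Finset.mem_product, Finset.mem_range, Finset.mem_range] at hp
        have hvol : volume (cell p) = ENNReal.ofReal (r ^ 2) := by
          rw [Measure.volume_eq_prod, Measure.prod_prod, Real.volume_Ico, Real.volume_Ico,
            ← ENNReal.ofReal_mul (by linarith)]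
          congr 1
          ring
        calc _ = ∫⁻ _ in cell p, G p.1 p.2 := by rw [setLIntegral_const, hvol, mul_comm]
          _ ≤ _ := setLIntegral_mono' (hcell p) fun a ha => h _ hp.1 _ hp.2 a ha.1 ha.2
    _ = ∫⁻ a in ⋃ p ∈ Finset.range N ×ˢ Finset.range N, cell p, Φ a :=
        (lintegral_biUnion_finset hdisj (fun p _ => hcell p) Φ).symm
    _ ≤ _ := setLIntegral_le_lintegral _ _

/-- The transversal profile of `U w̃_B` on the set of parameters of tubes meeting the square of
center `c` and side `r ^ 2`. -/
noncomputable def tubeProfile (U : ℝ × ℝ → ENNReal) (c : ℝ × ℝ) (r ξ : ℝ) : ℝ → ENNReal :=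
  (Set.Icc (c.1 + 2 * ξ * c.2 - 3 * r ^ 2 / 2) (c.1 + 2 * ξ * c.2 + 3 * r ^ 2 / 2)).indicator
    fun τ => ∫⁻ z, U z * ENNReal.ofReal (wtB c (r ^ 2) z) *
      ENNReal.ofReal (tailWt r (|z.1 + 2 * ξ * z.2 - τ| / r))

lemma measurable_tubeProfile {U : ℝ × ℝ → ENNReal} (hU : Measurable U) (c : ℝ × ℝ) (r ξ : ℝ) :
    Measurable (tubeProfile U c r ξ) := by
  have hwtB := measurable_wtB c (r ^ 2)
  have htail := measurable_tailWt r
  refine Measurable.indicator ?_ measurableSet_Icc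
  exact Measurable.lintegral_prod_right' (f := fun p : ℝ × (ℝ × ℝ) =>
    U p.2 * ENNReal.ofReal (wtB c (r ^ 2) p.2) *
      ENNReal.ofReal (tailWt r (|p.2.1 + 2 * ξ * p.2.2 - p.1| / r))) (by fun_prop)

lemma lintegral_tubeProfile_le {U : ℝ × ℝ → ENNReal} (hU : Measurable U) (c : ℝ × ℝ) {r : ℝ}
    (hr : 1 ≤ r) (ξ : ℝ) : ∫⁻ τ, tubeProfile U c r ξ τ ≤
      ENNReal.ofReal ((tailMass + 3) * r) * ∫⁻ z, U z * ENNReal.ofReal (wtB c (r ^ 2) z) := by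
  have hwtB := measurable_wtB c (r ^ 2)
  have htail := measurable_tailWt r
  unfold tubeProfile
  rw [lintegral_indicator measurableSet_Icc, lintegral_lintegral_swap (by fun_prop),
    ← lintegral_const_mul' _ _ ENNReal.ofReal_ne_top]
  refine lintegral_mono fun z => ?_
  rw [lintegral_const_mul _ (by fun_prop), mul_comm]
  exact mul_le_mul_left (setLIntegral_tailWt_le hr _ _) _

lemma tubeProfile_of_mem {U : ℝ × ℝ → ENNReal} {c a : ℝ × ℝ} {r ξ : ℝ} (hξ0 : 0 ≤ ξ) (hξ1 : ξ ≤ 1)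
    (h1 : |a.1 - c.1| ≤ r ^ 2 / 2) (h2 : |a.2 - c.2| ≤ r ^ 2 / 2) :
    tubeProfile U c r ξ (a.1 + 2 * ξ * a.2) =
      ∫⁻ z, U z * ENNReal.ofReal (wtB c (r ^ 2) z) *
        ENNReal.ofReal (tailWt r (|z.1 + 2 * ξ * z.2 - (a.1 + 2 * ξ * a.2)| / r)) := by
  refine Set.indicator_of_mem ?_ _
  rw [abs_le] at h1 h2
  constructor <;> nlinarith [mul_le_mul_of_nonneg_left h2.1 hξ0, mul_le_mul_of_nonneg_left h2.2 hξ0,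
    mul_le_mul_of_nonneg_right hξ1 (sq_nonneg r)]

/-- Bilinear Kakeya estimate for functions locally constant along transversal families of tubes. -/
lemma exists_sum_lintegral_wtB_mul_le : ∃ K : ℝ, 0 < K ∧ ∀ {U U' : ℝ × ℝ → ENNReal} {D : ENNReal}
    {c : ℝ × ℝ} {r ξ ξ' : ℝ} {N : ℕ}, Measurable U → Measurable U' → D ≠ ⊤ → (N : ℝ) = r → 1 ≤ r →
    0 ≤ ξ → ξ ≤ 1 → 0 ≤ ξ' → ξ' ≤ 1 → ξ ≠ ξ' →
    (∀ x : ℝ × ℝ, U x ≤ D * ∫⁻ s : ℝ, U (x.1 - 2 * ξ * r ^ 2 * s, x.2 + r ^ 2 * s) *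
      ENNReal.ofReal ((1 + |s|) ^ 202)⁻¹) →
    (∀ x : ℝ × ℝ, U' x ≤ D * ∫⁻ s : ℝ, U' (x.1 - 2 * ξ' * r ^ 2 * s, x.2 + r ^ 2 * s) *
      ENNReal.ofReal ((1 + |s|) ^ 202)⁻¹) →
    ENNReal.ofReal (r ^ 2) * ∑ i ∈ Finset.range N, ∑ j ∈ Finset.range N,
      (∫⁻ x, U x * ENNReal.ofReal (wtB (subCtr c (r ^ 2) r i j) r x)) *
        (∫⁻ x, U' x * ENNReal.ofReal (wtB (subCtr c (r ^ 2) r i j) r x)) ≤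
      D ^ 2 * ENNReal.ofReal (K * |ξ' - ξ|⁻¹) *
        ((∫⁻ z, U z * ENNReal.ofReal (wtB c (r ^ 2) z)) *
          ∫⁻ z, U' z * ENNReal.ofReal (wtB c (r ^ 2) z)) := by
  obtain ⟨K, hK, hbound⟩ := exists_lintegral_wtB_le
  have htm := tailMass_nonneg
  refine ⟨K ^ 2 * (tailMass + 3) ^ 2 / 2, by positivity, ?_⟩
  intro U U' D c r ξ ξ' N hU hU' hD hN hr hξ0 hξ1 hξ'0 hξ'1 hne hloc hloc'
  have hr0 : 0 < r := by linarith
  set V := tubeProfile U c r ξ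
  set V' := tubeProfile U' c r ξ'
  have hV : Measurable V := measurable_tubeProfile hU c r ξ
  have hV' : Measurable V' := measurable_tubeProfile hU' c r ξ'
  set H := D * ENNReal.ofReal (K / r) with hH
  have hHt : H ≠ ⊤ := ENNReal.mul_ne_top hD ENNReal.ofReal_ne_top
  have hcoord : ∀ (w x : ℝ) (i : ℕ), i < N →
      x ∈ Set.Ico (w - r ^ 2 / 2 + i * r) (w - r ^ 2 / 2 + (i + 1) * r) →
      |x - w| ≤ r ^ 2 / 2 ∧ |w - r ^ 2 / 2 + ((i : ℝ) + 1 / 2) * r - x| ≤ r / 2 := by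
    intro w x i hi hx
    have hi0 : (0 : ℝ) ≤ i := i.cast_nonneg
    have hi1 : (i : ℝ) + 1 ≤ r := by rw [← hN]; exact_mod_cast hi
    obtain ⟨hx1, hx2⟩ := hx
    rw [abs_le, abs_le]
    refine ⟨⟨?_, ?_⟩, ?_, ?_⟩ <;> nlinarith
  have hcells := ofReal_mul_sum_cells_le hr0 N (c.1 - r ^ 2 / 2) (c.2 - r ^ 2 / 2)
    (G := fun i j => (∫⁻ x, U x * ENNReal.ofReal (wtB (subCtr c (r ^ 2) r i j) r x)) *
        (∫⁻ x, U' x * ENNReal.ofReal (wtB (subCtr c (r ^ 2) r i j) r x)))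
    (Φ := fun a => (H ^ 2) * (V (a.1 + 2 * ξ * a.2) * V' (a.1 + 2 * ξ' * a.2))) ?_
  · refine hcells.trans ?_
    rw [lintegral_const_mul' _ _ (ENNReal.pow_ne_top hHt), lintegral_transversal hV hV' hne]
    calc _ ≤ H ^ 2 * (ENNReal.ofReal |(2 * (ξ' - ξ))⁻¹| *
          ((ENNReal.ofReal ((tailMass + 3) * r) * ∫⁻ z, U z * ENNReal.ofReal (wtB c (r ^ 2) z)) *
          (ENNReal.ofReal ((tailMass + 3) * r) *
            ∫⁻ z, U' z * ENNReal.ofReal (wtB c (r ^ 2) z)))) := by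
          gcongr
          · exact lintegral_tubeProfile_le hU c hr ξ
          · exact lintegral_tubeProfile_le hU' c hr ξ'
      _ = _ := by
          have e : K ^ 2 * (tailMass + 3) ^ 2 / 2 * |ξ' - ξ|⁻¹ = (K / r) ^ 2 *
              |(2 * (ξ' - ξ))⁻¹| * ((tailMass + 3) * r * ((tailMass + 3) * r)) := by
            rw [abs_inv, abs_mul, abs_two, mul_inv]
            field_simp
          have hT : 0 ≤ (tailMass + 3) * r := by positivity
          rw [e]
          generalize (tailMass + 3) * r = T at hT
          rw [ENNReal.ofReal_mul (by positivity), ENNReal.ofReal_mul (by positivity),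
            ENNReal.ofReal_mul hT, ENNReal.ofReal_pow (by positivity), hH]
          ring
  · intro i hi j hj a ha1 ha2
    obtain ⟨h1, h3⟩ := hcoord _ _ i hi ha1
    obtain ⟨h2, h4⟩ := hcoord _ _ j hj ha2
    have g1 := hbound (d := subCtr c (r ^ 2) r i j) hU hD hr hξ0 hξ1 hloc h1 h2 h3 h4
    have g2 := hbound (d := subCtr c (r ^ 2) r i j) hU' hD hr hξ'0 hξ'1 hloc' h1 h2 h3 h4
    rw [← tubeProfile_of_mem hξ0 hξ1 h1 h2] at g1
    rw [← tubeProfile_of_mem hξ'0 hξ'1 h1 h2] at g2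
    refine (mul_le_mul' g1 g2).trans_eq ?_
    ring

lemma integrable_one_add_norm_sub_div (c : ℝ × ℝ) {R : ℝ} (hR : 0 < R) :
    Integrable fun x : ℝ × ℝ => (1 + ‖x - c‖ / R) ^ (-100 : ℤ) := by
  have h : Integrable fun y : ℝ × ℝ => (1 + ‖y‖) ^ (-(100 : ℝ)) :=
    integrable_one_add_norm (by
      rw [Module.finrank_prod, Module.finrank_self]; norm_num)
  refine ((h.comp_smul (R := R⁻¹) (by positivity)).comp_sub_right c).congr
    (Filter.Eventually.of_forall fun x => ?_)
  have h2 : ‖R⁻¹ • (x - c)‖ = ‖x - c‖ / R := by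
    rw [norm_smul, Real.norm_of_nonneg (by positivity)]; ring
  show (1 + ‖R⁻¹ • (x - c)‖) ^ (-(100 : ℝ)) = (1 + ‖x - c‖ / R) ^ (-100 : ℤ)
  rw [h2, ← Real.rpow_intCast]
  norm_num

lemma integrable_wtB (c : ℝ × ℝ) {R : ℝ} (hR : 0 < R) : Integrable (wtB c R) := by
  refine (integrable_one_add_norm_sub_div c hR).mono' (measurable_wtB c R).aestronglyMeasurable
    (Filter.Eventually.of_forall fun x => ?_)
  rw [Real.norm_of_nonneg (wtB_nonneg c hR.le x)]
  have hle : ∀ t : ℝ, 0 ≤ t → 0 ≤ (1 + t) ^ (-100 : ℤ) ∧ (1 + t) ^ (-100 : ℤ) ≤ 1 := fun t ht =>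
    ⟨zpow_nonneg (by linarith) _, zpow_le_one_of_nonpos₀ (by linarith) (by norm_num)⟩
  obtain ⟨h1, h1'⟩ := hle (|x.1 - c.1| / R) (by positivity)
  obtain ⟨h2, h2'⟩ := hle (|x.2 - c.2| / R) (by positivity)
  rw [wtB, Prod.norm_def, Prod.fst_sub, Prod.snd_sub, Real.norm_eq_abs, Real.norm_eq_abs]
  rcases max_cases |x.1 - c.1| |x.2 - c.2| with ⟨h, -⟩ | ⟨h, -⟩ <;> rw [h]
  · exact mul_le_of_le_one_right h1 h2'
  · exact mul_le_of_le_one_left h2 h1'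

lemma wtB_pos (c : ℝ × ℝ) {R : ℝ} (hR : 0 < R) (x : ℝ × ℝ) : 0 < wtB c R x :=
  mul_pos (zpow_pos (by positivity) _) (zpow_pos (by positivity) _)

lemma ofReal_integral_extOp_rpow_mul {q a b : ℝ} (hq : 0 ≤ q) {g : ℝ → ℂ}
    (hg : IntegrableOn g (Set.Icc a b)) {w : ℝ × ℝ → ℝ} (hw : Integrable w) (hw0 : ∀ x, 0 ≤ w x) :
    ENNReal.ofReal (∫ x, ‖extOp a b g x‖ ^ q * w x) =
      ∫⁻ x, ‖extOp a b g x‖ₑ ^ q * ENNReal.ofReal (w x) := by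
  have hc : Continuous fun x => ‖extOp a b g x‖ ^ q :=
    (continuous_extOp hg).norm.rpow_const fun _ => Or.inr hq
  rw [ofReal_integral_eq_lintegral_ofReal]
  · refine lintegral_congr fun x => ?_
    rw [ENNReal.ofReal_mul (by positivity), ← ENNReal.ofReal_rpow_of_nonneg (norm_nonneg _) hq,
      ofReal_norm]
  · refine hw.bdd_mul (c := (∫ ξ in Set.Icc a b, ‖g ξ‖) ^ q) hc.aestronglyMeasurable
      (Filter.Eventually.of_forall fun x => ?_)
    rw [Real.norm_of_nonneg (by positivity)]
    exact Real.rpow_le_rpow (norm_nonneg _) (norm_extOp_le a b g x) hq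
  · exact Filter.Eventually.of_forall fun x => mul_nonneg (by positivity) (hw0 x)

lemma integral_norm_rpow_mul_nonneg {w : ℝ × ℝ → ℝ} (hw : ∀ x, 0 ≤ w x) (q : ℝ) (f : ℝ × ℝ → ℂ) :
    0 ≤ ∫ x, ‖f x‖ ^ q * w x :=
  integral_nonneg fun x => mul_nonneg (Real.rpow_nonneg (norm_nonneg _) _) (hw x)

lemma shLp_nonneg {p R : ℝ} {w : ℝ × ℝ → ℝ} (hw : ∀ x, 0 ≤ w x) (f : ℝ × ℝ → ℂ) :
    0 ≤ shLp p R w f := by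
  exact Real.rpow_nonneg (mul_nonneg (by positivity) (integral_norm_rpow_mul_nonneg hw p f)) _

lemma shLp_rpow {q R : ℝ} (hq : q ≠ 0) {w : ℝ × ℝ → ℝ} (hw : ∀ x, 0 ≤ w x) (f : ℝ × ℝ → ℂ) :
    shLp q R w f ^ q = (R ^ 2)⁻¹ * ∫ x, ‖f x‖ ^ q * w x := by
  rw [shLp, one_div, Real.rpow_inv_rpow (mul_nonneg (by positivity)
    (integral_norm_rpow_mul_nonneg hw q f)) hq]

lemma shLp_wtB_eq_zero {q a b r R : ℝ} (hq : 0 < q) (hR : 0 < R)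
    {g : ℝ → ℂ} (hg : IntegrableOn g (Set.Icc a b)) {c : ℝ × ℝ} (d : ℝ × ℝ)
    (h : shLp q R (wtB c R) (extOp a b g) = 0) : shLp q r (wtB d r) (extOp a b g) = 0 := by
  have h1 := shLp_rpow (R := R) hq.ne' (wtB_nonneg c hR.le) (extOp a b g)
  rw [h, Real.zero_rpow hq.ne', eq_comm, mul_eq_zero, or_iff_right (by positivity)] at h1
  have h2 := ofReal_integral_extOp_rpow_mul hq.le hg (integrable_wtB c hR) (wtB_nonneg c hR.le)
  have hm : Measurable fun x => ‖extOp a b g x‖ₑ ^ q :=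
    (continuous_extOp hg).measurable.enorm.pow_const q
  rw [h1, ENNReal.ofReal_zero, eq_comm,
    lintegral_eq_zero_iff (by exact hm.mul (measurable_wtB c R).ennreal_ofReal)] at h2
  rw [shLp, integral_eq_zero_of_ae, mul_zero, Real.zero_rpow (by positivity)]
  filter_upwards [h2] with x hx
  have hx' : extOp a b g x = 0 := by
    simpa [(ENNReal.ofReal_pos.2 (wtB_pos c hR x)).ne', hq] using hx
  simp [hx', Real.zero_rpow hq.ne']

lemma exists_avg_shLp_mul_le : ∃ K : ℝ, 0 < K ∧ ∃ A : ℝ, 1 ≤ A ∧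
    ∀ {q r ξ η ξ' η' : ℝ} {N : ℕ} {g : ℝ → ℂ} (c : ℝ × ℝ), 1 < q → (N : ℝ) = r → 1 ≤ r →
    0 ≤ ξ → ξ ≤ 1 → 0 ≤ ξ' → ξ' ≤ 1 → ξ ≠ ξ' → (η - ξ) ^ 2 * r ^ 2 ≤ 1 →
    (η' - ξ') ^ 2 * r ^ 2 ≤ 1 → IntegrableOn g (Set.Icc ξ η) → IntegrableOn g (Set.Icc ξ' η') →
    (r ^ 2)⁻¹ * ∑ i ∈ Finset.range N, ∑ j ∈ Finset.range N,
      shLp q r (wtB (subCtr c (r ^ 2) r i j) r) (extOp ξ η g) ^ q *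
        shLp q r (wtB (subCtr c (r ^ 2) r i j) r) (extOp ξ' η' g) ^ q ≤
      (A ^ q) ^ 2 * (K * |ξ' - ξ|⁻¹) * (shLp q (r ^ 2) (wtB c (r ^ 2)) (extOp ξ η g) ^ q *
        shLp q (r ^ 2) (wtB c (r ^ 2)) (extOp ξ' η' g) ^ q) := by
  obtain ⟨K, hK, hbound⟩ := exists_sum_lintegral_wtB_mul_le
  obtain ⟨A, hA, hloc⟩ := exists_extOp_rpow_le
  refine ⟨K, hK, A, hA, ?_⟩
  intro q r ξ η ξ' η' N g c hq hN hr hξ0 hξ1 hξ'0 hξ'1 hne hη hη' hg hg'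
  have hr0 : 0 < r := by linarith
  have hq0 : 0 < q := by linarith
  have hwt := fun d => wtB_nonneg d hr0.le
  have hw := wtB_nonneg c (sq_nonneg r)
  have key := hbound (c := c) (D := ENNReal.ofReal (A ^ q))
    (U := fun x => ‖extOp ξ η g x‖ₑ ^ q) (U' := fun x => ‖extOp ξ' η' g x‖ₑ ^ q)
    ((continuous_extOp hg).measurable.enorm.pow_const q)
    ((continuous_extOp hg').measurable.enorm.pow_const q) ENNReal.ofReal_ne_top hN hr
    hξ0 hξ1 hξ'0 hξ'1 hne (fun x => hloc hq (sq_nonneg r) hη hg x)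
    (fun x => hloc hq (sq_nonneg r) hη' hg' x)
  simp only [← ofReal_integral_extOp_rpow_mul hq0.le hg (integrable_wtB _ hr0) (hwt _),
    ← ofReal_integral_extOp_rpow_mul hq0.le hg' (integrable_wtB _ hr0) (hwt _),
    ← ofReal_integral_extOp_rpow_mul hq0.le hg (integrable_wtB c (by positivity)) hw,
    ← ofReal_integral_extOp_rpow_mul hq0.le hg' (integrable_wtB c (by positivity)) hw] at key
  simp only [shLp_rpow hq0.ne' (hwt _), shLp_rpow hq0.ne' hw]
  have hX := fun d => integral_norm_rpow_mul_nonneg (hwt d) q (extOp ξ η g)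
  have hX' := fun d => integral_norm_rpow_mul_nonneg (hwt d) q (extOp ξ' η' g)
  have hY := integral_norm_rpow_mul_nonneg hw q (extOp ξ η g)
  have hY' := integral_norm_rpow_mul_nonneg hw q (extOp ξ' η' g)
  generalize (∫ x, ‖extOp ξ η g x‖ ^ q * wtB c (r ^ 2) x) = Y at key hY ⊢
  generalize (∫ x, ‖extOp ξ' η' g x‖ ^ q * wtB c (r ^ 2) x) = Y' at key hY' ⊢
  generalize hXe : (fun d => ∫ x, ‖extOp ξ η g x‖ ^ q * wtB d r x) = X at hX
  generalize hXe' : (fun d => ∫ x, ‖extOp ξ' η' g x‖ ^ q * wtB d r x) = X' at hX'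
  have hXd := congrFun hXe
  have hXd' := congrFun hXe'
  simp only [hXd, hXd'] at key hX hX' ⊢
  simp only [← ENNReal.ofReal_mul (hX _)] at key
  have hXX : ∀ d, 0 ≤ X d * X' d := fun d => mul_nonneg (hX d) (hX' d)
  simp only [← ENNReal.ofReal_sum_of_nonneg fun i _ => hXX _] at key
  rw [← ENNReal.ofReal_sum_of_nonneg fun i _ => Finset.sum_nonneg fun j _ => hXX _,
    ← ENNReal.ofReal_mul (by positivity), ← ENNReal.ofReal_mul hY,
    ← ENNReal.ofReal_pow (by positivity), ← ENNReal.ofReal_mul (by positivity),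
    ← ENNReal.ofReal_mul (by positivity), ENNReal.ofReal_le_ofReal_iff (by positivity)] at key
  have hsum : ∑ i ∈ Finset.range N, ∑ j ∈ Finset.range N,
      (r ^ 2)⁻¹ * X (subCtr c (r ^ 2) r i j) * ((r ^ 2)⁻¹ * X' (subCtr c (r ^ 2) r i j)) =
      ((r ^ 2)⁻¹) ^ 2 * ∑ i ∈ Finset.range N, ∑ j ∈ Finset.range N,
        X (subCtr c (r ^ 2) r i j) * X' (subCtr c (r ^ 2) r i j) := by
    simp only [Finset.mul_sum]
    refine Finset.sum_congr rfl fun i _ => Finset.sum_congr rfl fun j _ => by ring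
  rw [hsum]
  generalize (∑ i ∈ Finset.range N, ∑ j ∈ Finset.range N,
        X (subCtr c (r ^ 2) r i j) * X' (subCtr c (r ^ 2) r i j)) = S at key
  calc _ = ((r ^ 2)⁻¹) ^ 4 * (r ^ 2 * S) := by field_simp
    _ ≤ ((r ^ 2)⁻¹) ^ 4 * _ := mul_le_mul_of_nonneg_left key (by positivity)
    _ = _ := by
      generalize A ^ q = B
      field_simp

/-- A weighted Hölder inequality: the weights `W` depend only on `A`, and linearize the `t`-th power
of `∑ (a j) ^ 2` for every family `a` whose support is contained in that of `A`. -/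
lemma exists_weight_rpow_sum_sq_le {ι : Type*} (s : Finset ι) (A : ι → ℝ) {t : ℝ} (ht : 1 ≤ t) :
    ∃ W : ι → ℝ, (∀ j, 0 ≤ W j) ∧
      ∑ j ∈ s, W j * (A j ^ 2) ^ t ≤ (∑ j ∈ s, A j ^ 2) ^ t ∧
      ∀ a : ι → ℝ, (∀ j ∈ s, A j = 0 → a j = 0) →
        (∑ j ∈ s, a j ^ 2) ^ t ≤ ∑ j ∈ s, W j * (a j ^ 2) ^ t := by
  have hS : 0 ≤ ∑ j ∈ s, A j ^ 2 := Finset.sum_nonneg fun j _ => sq_nonneg _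
  have ht0 : 0 < t := by linarith
  refine ⟨fun j => (∑ j ∈ s, A j ^ 2) ^ (t - 1) * (A j ^ 2 * ((A j ^ 2)⁻¹) ^ t),
    fun j => by positivity, ?_, fun a ha => ?_⟩
  · calc _ ≤ ∑ j ∈ s, (∑ j ∈ s, A j ^ 2) ^ (t - 1) * A j ^ 2 := by
          refine Finset.sum_le_sum fun j _ => ?_
          rw [mul_assoc, mul_assoc, ← Real.mul_rpow (by positivity) (by positivity)]
          gcongr
          refine mul_le_of_le_one_right (by positivity) (Real.rpow_le_one (by positivity) ?_ ht0.le)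
          exact inv_mul_le_one
      _ = _ := by
          rw [← Finset.mul_sum, ← Real.rpow_add_one' hS (by linarith), sub_add_cancel]
  · have h := Real.inner_le_weight_mul_Lp_of_nonneg s ht (fun j => A j ^ 2)
      (fun j => (A j ^ 2)⁻¹ * a j ^ 2) (fun j => by positivity) (fun j => by positivity)
    have h1 : ∑ j ∈ s, A j ^ 2 * ((A j ^ 2)⁻¹ * a j ^ 2) = ∑ j ∈ s, a j ^ 2 := by
      refine Finset.sum_congr rfl fun j hj => ?_
      by_cases hA : A j = 0
      · simp [hA, ha j hj hA]
      · field_simp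
    rw [h1] at h
    refine (Real.rpow_le_rpow (Finset.sum_nonneg fun j _ => sq_nonneg _) h ht0.le).trans_eq ?_
    have h2 : 0 ≤ ∑ j ∈ s, A j ^ 2 * ((A j ^ 2)⁻¹ * a j ^ 2) ^ t :=
      Finset.sum_nonneg fun j _ => by positivity
    rw [Real.mul_rpow (by positivity) (by positivity), ← Real.rpow_mul hS, ← Real.rpow_mul h2,
      inv_mul_cancel₀ ht0.ne', Real.rpow_one, sub_mul, inv_mul_cancel₀ ht0.ne', one_mul,
      Finset.mul_sum]
    refine Finset.sum_congr rfl fun j _ => ?_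
    rw [Real.mul_rpow (by positivity) (by positivity)]
    ring

lemma mul_sum_rpow_sum_sq_mul_le {κ ι : Type*} (σ : Finset κ) (s : Finset ι) {a a' : κ → ι → ℝ}
    {A A' : ι → ℝ} {t M B : ℝ} (ht : 1 ≤ t) (hM : 0 ≤ M) (hB : 0 ≤ B)
    (h0 : ∀ x, ∀ j ∈ s, A j = 0 → a x j = 0) (h0' : ∀ x, ∀ j ∈ s, A' j = 0 → a' x j = 0)
    (h : ∀ j ∈ s, ∀ j' ∈ s, M * ∑ x ∈ σ, (a x j ^ 2) ^ t * (a' x j' ^ 2) ^ t ≤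
      B * ((A j ^ 2) ^ t * (A' j' ^ 2) ^ t)) :
    M * ∑ x ∈ σ, (∑ j ∈ s, a x j ^ 2) ^ t * (∑ j ∈ s, a' x j ^ 2) ^ t ≤
      B * ((∑ j ∈ s, A j ^ 2) ^ t * (∑ j ∈ s, A' j ^ 2) ^ t) := by
  obtain ⟨W, hW, hWA, hWa⟩ := exists_weight_rpow_sum_sq_le s A ht
  obtain ⟨W', hW', hWA', hWa'⟩ := exists_weight_rpow_sum_sq_le s A' ht
  calc M * ∑ x ∈ σ, (∑ j ∈ s, a x j ^ 2) ^ t * (∑ j ∈ s, a' x j ^ 2) ^ t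
      ≤ M * ∑ x ∈ σ, (∑ j ∈ s, W j * (a x j ^ 2) ^ t) * ∑ j' ∈ s, W' j' * (a' x j' ^ 2) ^ t := by
        gcongr with x
        · exact Finset.sum_nonneg fun j _ => mul_nonneg (hW j) (by positivity)
        · exact hWa _ (h0 x)
        · exact hWa' _ (h0' x)
    _ = ∑ j ∈ s, ∑ j' ∈ s, W j * W' j' *
          (M * ∑ x ∈ σ, (a x j ^ 2) ^ t * (a' x j' ^ 2) ^ t) := by
        simp only [Finset.sum_mul_sum]
        simp only [Finset.mul_sum]
        rw [Finset.sum_comm]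
        refine Finset.sum_congr rfl fun j _ => ?_
        rw [Finset.sum_comm]
        exact Finset.sum_congr rfl fun j' _ => Finset.sum_congr rfl fun x _ => by ring
    _ ≤ ∑ j ∈ s, ∑ j' ∈ s, W j * W' j' * (B * ((A j ^ 2) ^ t * (A' j' ^ 2) ^ t)) :=
        Finset.sum_le_sum fun j hj => Finset.sum_le_sum fun j' hj' =>
          mul_le_mul_of_nonneg_left (h j hj j' hj') (mul_nonneg (hW j) (hW' j'))
    _ = B * ((∑ j ∈ s, W j * (A j ^ 2) ^ t) * ∑ j' ∈ s, W' j' * (A' j' ^ 2) ^ t) := by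
        simp only [Finset.sum_mul_sum]
        simp only [Finset.mul_sum]
        exact Finset.sum_congr rfl fun j _ => Finset.sum_congr rfl fun j' _ => by ring
    _ ≤ _ := by
        gcongr
        exact Finset.sum_nonneg fun j _ => mul_nonneg (hW' j) (by positivity)

lemma interval_bounds {k b i J : ℕ} (hb : 1 ≤ b) (hi : i < k) (hJ : J < k ^ (b - 1)) :
    (i : ℝ) / k ≤ (i : ℝ) / k + (J : ℝ) / (k : ℝ) ^ b ∧
      (i : ℝ) / k + ((J : ℝ) + 1) / (k : ℝ) ^ b ≤ ((i : ℝ) + 1) / k := by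
  have hk : (0 : ℝ) < k := by exact_mod_cast (i.zero_le.trans_lt hi)
  refine ⟨le_add_of_nonneg_right (by positivity), ?_⟩
  have hJ' : (J : ℝ) + 1 ≤ (k : ℝ) ^ (b - 1) := by exact_mod_cast hJ
  have hkb : (k : ℝ) ^ b = (k : ℝ) ^ (b - 1) * k := by
    rw [← pow_succ, Nat.sub_add_cancel hb]
  rw [add_div (i : ℝ), hkb]
  refine add_le_add_right ?_ _
  rw [div_le_div_iff₀ (by positivity) hk]
  nlinarith

lemma inv_abs_sub_le {k i i' : ℕ} {ξ ξ' : ℝ} (hk : 0 < k) (h : i + 1 < i' ∨ i' + 1 < i)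
    (h1 : (i : ℝ) / k ≤ ξ) (h2 : ξ ≤ ((i : ℝ) + 1) / k) (h1' : (i' : ℝ) / k ≤ ξ')
    (h2' : ξ' ≤ ((i' : ℝ) + 1) / k) : ξ ≠ ξ' ∧ |ξ' - ξ|⁻¹ ≤ k := by
  have hk' : (0 : ℝ) < k := by exact_mod_cast hk
  rw [div_le_iff₀ hk'] at h1 h1'
  rw [le_div_iff₀ hk'] at h2 h2'
  have hle : (k : ℝ)⁻¹ ≤ |ξ' - ξ| := by
    rw [inv_le_iff_one_le_mul₀ hk']
    rcases h with h | h
    · have h3 : (i : ℝ) + 1 + 1 ≤ i' := by exact_mod_cast h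
      nlinarith [le_abs_self (ξ' - ξ)]
    · have h3 : (i' : ℝ) + 1 + 1 ≤ i := by exact_mod_cast h
      nlinarith [neg_abs_le (ξ' - ξ)]
  have hpos : 0 < |ξ' - ξ| := (inv_pos.2 hk').trans_le hle
  refine ⟨fun e => ?_, inv_le_of_inv_le₀ hk' hle⟩
  simp [e] at hpos

/-- Ball inflation: with `ν = 1/k`, `I₁ = [i/k,(i+1)/k]`, `I₂ = [i'/k,(i'+1)/k]`
`ν`-separated intervals of `P_ν([0,1])`, and `Δ'` a square of side `ν^{-2b} = k^{2b}`,
`Avg_{Δ ∈ P_{ν^{-b}}(Δ')} Π_i (Σ_{J ∈ P_{ν^b}(I_i)} ‖E_J g‖_{L^{p/2}_#(w̃_Δ)}²)^{p/4}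
 ≤ e^{Cp} ν⁻¹ (b log(1/ν))^{p/2} Π_i (Σ_{J ∈ P_{ν^b}(I_i)} ‖E_J g‖_{L^{p/2}_#(w̃_{Δ'})}²)^{p/4}`. -/
theorem ball_inflation :
    ∃ C : ℝ, 0 < C ∧ ∀ p : ℝ, 4 < p → ∀ b : ℕ, 1 ≤ b → ∀ k : ℕ, 2 ≤ k →
      ∀ i i' : ℕ, i < k → i' < k → (i + 1 < i' ∨ i' + 1 < i) →
      ∀ g : ℝ → ℂ, IntegrableOn g (Set.Icc 0 1) → ∀ c : ℝ × ℝ,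
        (((k ^ b : ℕ) : ℝ) ^ 2)⁻¹ *
            ∑ a ∈ Finset.range (k ^ b), ∑ a' ∈ Finset.range (k ^ b),
              ((∑ J ∈ Finset.range (k ^ (b - 1)),
                  shLp (p / 2) ((k : ℝ) ^ b)
                    (wtB (subCtr c ((k : ℝ) ^ (2 * b)) ((k : ℝ) ^ b) a a') ((k : ℝ) ^ b))
                    (extOp ((i : ℝ) / k + (J : ℝ) / (k : ℝ) ^ b)
                      ((i : ℝ) / k + ((J : ℝ) + 1) / (k : ℝ) ^ b) g) ^ 2) ^ (p / 4) *
                (∑ J ∈ Finset.range (k ^ (b - 1)),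
                  shLp (p / 2) ((k : ℝ) ^ b)
                    (wtB (subCtr c ((k : ℝ) ^ (2 * b)) ((k : ℝ) ^ b) a a') ((k : ℝ) ^ b))
                    (extOp ((i' : ℝ) / k + (J : ℝ) / (k : ℝ) ^ b)
                      ((i' : ℝ) / k + ((J : ℝ) + 1) / (k : ℝ) ^ b) g) ^ 2) ^ (p / 4))
          ≤ Real.exp (C * p) * (k : ℝ) * ((b : ℝ) * Real.log k) ^ (p / 2) *
              ((∑ J ∈ Finset.range (k ^ (b - 1)),
                  shLp (p / 2) ((k : ℝ) ^ (2 * b)) (wtB c ((k : ℝ) ^ (2 * b)))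
                    (extOp ((i : ℝ) / k + (J : ℝ) / (k : ℝ) ^ b)
                      ((i : ℝ) / k + ((J : ℝ) + 1) / (k : ℝ) ^ b) g) ^ 2) ^ (p / 4) *
                (∑ J ∈ Finset.range (k ^ (b - 1)),
                  shLp (p / 2) ((k : ℝ) ^ (2 * b)) (wtB c ((k : ℝ) ^ (2 * b)))
                    (extOp ((i' : ℝ) / k + (J : ℝ) / (k : ℝ) ^ b)
                      ((i' : ℝ) / k + ((J : ℝ) + 1) / (k : ℝ) ^ b) g) ^ 2) ^ (p / 4)) := by
  obtain ⟨K, hK, A, hA, hpair⟩ := exists_avg_shLp_mul_le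
  have hA0 : 0 < A := by linarith
  refine ⟨Real.log A + K, by linarith [Real.log_nonneg hA], ?_⟩
  intro p hp b hb k hk i i' hi hi' hsep g hg c
  have hk3 : (3 : ℝ) ≤ k := by exact_mod_cast (by omega : 3 ≤ k)
  have hk0 : (0 : ℝ) < k := by linarith
  have hlog : 1 ≤ (b : ℝ) * Real.log k := by
    have h1 : 1 ≤ Real.log k := by
      rw [Real.le_log_iff_exp_le hk0]
      linarith [Real.exp_one_lt_d9]
    exact one_le_mul_of_one_le_of_one_le (by exact_mod_cast hb) h1
  have hconst : (A ^ (p / 2)) ^ 2 * (K * k) ≤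
      Real.exp ((Real.log A + K) * p) * (k : ℝ) * ((b : ℝ) * Real.log k) ^ (p / 2) := by
    have h1 : (A ^ (p / 2)) ^ 2 = Real.exp (Real.log A * p) := by
      rw [← Real.rpow_natCast, ← Real.rpow_mul hA0.le, Real.rpow_def_of_pos hA0]
      push_cast
      ring_nf
    have h2 : K ≤ Real.exp (K * p) := by nlinarith [Real.add_one_le_exp (K * p)]
    rw [h1, ← mul_assoc, add_mul, Real.exp_add]
    exact (mul_le_mul_of_nonneg_right (mul_le_mul_of_nonneg_left h2 (by positivity)) hk0.le).trans
      (le_mul_of_one_le_right (by positivity) (Real.one_le_rpow hlog (by linarith)))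
  have hr : (1 : ℝ) ≤ (k : ℝ) ^ b := one_le_pow₀ (by linarith)
  have hlen : ∀ i J : ℕ, ((i : ℝ) / k + ((J : ℝ) + 1) / (k : ℝ) ^ b -
      ((i : ℝ) / k + (J : ℝ) / (k : ℝ) ^ b)) ^ 2 * ((k : ℝ) ^ b) ^ 2 ≤ 1 := fun i J => by
    rw [add_sub_add_left_eq_sub, ← sub_div, add_sub_cancel_left, one_div, inv_pow,
      inv_mul_cancel₀ (by positivity)]
  have hunit : ∀ {i J : ℕ}, i < k → J < k ^ (b - 1) →
      0 ≤ (i : ℝ) / k + (J : ℝ) / (k : ℝ) ^ b ∧ (i : ℝ) / k + ((J : ℝ) + 1) / (k : ℝ) ^ b ≤ 1 := by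
    intro i J hi hJ
    refine ⟨by positivity, (interval_bounds hb hi hJ).2.trans ?_⟩
    rw [div_le_one hk0]
    exact_mod_cast hi
  have hmono : ∀ i J : ℕ, (i : ℝ) / k + (J : ℝ) / (k : ℝ) ^ b ≤
      (i : ℝ) / k + ((J : ℝ) + 1) / (k : ℝ) ^ b := fun i J => by gcongr; linarith
  have hint : ∀ {i J : ℕ}, i < k → J < k ^ (b - 1) →
      IntegrableOn g (Set.Icc ((i : ℝ) / k + (J : ℝ) / (k : ℝ) ^ b)
        ((i : ℝ) / k + ((J : ℝ) + 1) / (k : ℝ) ^ b)) := fun hi hJ =>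
    hg.mono_set (Set.Icc_subset_Icc (hunit hi hJ).1 (hunit hi hJ).2)
  have hsq : ∀ {x : ℝ}, 0 ≤ x → (x ^ 2) ^ (p / 4) = x ^ (p / 2) := fun hx => by
    rw [← Real.rpow_natCast, ← Real.rpow_mul hx]
    push_cast
    ring_nf
  rw [pow_mul' (k : ℝ) 2 b, ← Finset.sum_product']
  push_cast
  refine le_trans ?_ (mul_le_mul_of_nonneg_right hconst (by positivity))
  refine mul_sum_rpow_sum_sq_mul_le (Finset.range (k ^ b) ×ˢ Finset.range (k ^ b)) _
    (by linarith) (by positivity) (by positivity)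
    (fun x J hJ h => shLp_wtB_eq_zero (by linarith) (pow_pos (pow_pos hk0 b) 2)
      (hint hi (Finset.mem_range.1 hJ)) _ h)
    (fun x J hJ h => shLp_wtB_eq_zero (by linarith) (pow_pos (pow_pos hk0 b) 2)
      (hint hi' (Finset.mem_range.1 hJ)) _ h) fun J hJ J' hJ' => ?_
  rw [Finset.mem_range] at hJ hJ'
  obtain ⟨h1, h2⟩ := interval_bounds hb hi hJ
  obtain ⟨h1', h2'⟩ := interval_bounds hb hi' hJ'
  obtain ⟨hne, hinv⟩ := inv_abs_sub_le (by omega) hsep h1 ((hmono i J).trans h2) h1'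
    ((hmono i' J').trans h2')
  have hwc := wtB_nonneg c (sq_nonneg ((k : ℝ) ^ b))
  have hwd := fun d => wtB_nonneg d (by linarith : 0 ≤ (k : ℝ) ^ b)
  simp only [hsq (shLp_nonneg (hwd _) _), hsq (shLp_nonneg hwc _), Finset.sum_product]
  refine (hpair c (by linarith) (by push_cast; rfl) hr (hunit hi hJ).1
    ((hmono i J).trans (hunit hi hJ).2) (hunit hi' hJ').1
    ((hmono i' J').trans (hunit hi' hJ').2) hne (hlen i J) (hlen i' J') (hint hi hJ)
    (hint hi' hJ')).trans ?_
  refine mul_le_mul_of_nonneg_right ?_ (mul_nonneg (Real.rpow_nonneg (shLp_nonneg hwc _) _)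
    (Real.rpow_nonneg (shLp_nonneg hwc _) _))
  gcongr
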